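/- arXiv:1010.4515 — 6 statements merged into one kernel-verified Lean document; each statement's English description precedes it below -/
import Mathlib

section
/- Let (𝒳, 𝒮, μ) be a probability space and let 𝒞 ⊆ 𝒮 be any family of measurable sets. Then at least one of the following holds: (i) 𝒞 is finitely approximable with respect to μ, or (ii) 𝒞 has infinite VC dimension. -/
open MeasureTheory Set Filter

/-- `𝒞` shatters the finite set `D` if every subset of `D` is cut out by some `C ∈ 𝒞`. -/
def Shatters {X : Type*} (𝒞 : Set (Set X)) (D : Finset X) : Prop :=
  ∀ B ⊆ D, ∃ C ∈ 𝒞, ∀ x ∈ D, x ∈ C ↔ x ∈ B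

/-- `𝒞` has finite VC dimension: the cardinalities of shattered finite sets are bounded. -/
def FiniteVC {X : Type*} (𝒞 : Set (Set X)) : Prop :=
  ∃ k : ℕ, ∀ D : Finset X, Shatters 𝒞 D → D.card ≤ k

/-- `π` is a finite measurable partition of the whole space. -/
def IsFinitePartition {X : Type*} [MeasurableSpace X] (π : Set (Set X)) : Prop :=
  π.Finite ∧ (∀ A ∈ π, MeasurableSet A) ∧
    (∀ A ∈ π, ∀ B ∈ π, A ≠ B → Disjoint A B) ∧ ⋃₀ π = Set.univ

/-- The `π`-boundary of `C`: union of the cells of `π` meeting both `C` and `Cᶜ`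
with positive measure. -/
def piBoundary {X : Type*} [MeasurableSpace X] (μ : Measure X) (π : Set (Set X))
    (C : Set X) : Set X :=
  ⋃₀ {A ∈ π | 0 < μ (A ∩ C) * μ (A ∩ Cᶜ)}

/-- `𝒞` is finitely approximable w.r.t. `μ`: for every `ε > 0` there is a finite measurable
partition `π` such that `μ (∂(C : π)) ≤ ε` for every `C ∈ 𝒞`. -/
def FinitelyApproximable {X : Type*} [MeasurableSpace X] (μ : Measure X)
    (𝒞 : Set (Set X)) : Prop :=
  ∀ ε : ENNReal, 0 < ε → ∃ π : Set (Set X), IsFinitePartition π ∧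
    ∀ C ∈ 𝒞, μ (piBoundary μ π C) ≤ ε

/-- Setwise limits along an ultrafilter of measures dominated by a fixed finite measure are
measures. -/
theorem exists_measure_tendsto_ultrafilter {X ι : Type*} [MeasurableSpace X] (U : Ultrafilter ι)
    (μ : Measure X) [IsFiniteMeasure μ] (ν : ι → Measure X) (hν : ∀ i, ν i ≤ μ) :
    ∃ ρ : Measure X, ∀ A, MeasurableSet A →
      Tendsto (fun i => ν i A) U (nhds (ρ A)) := by
  have hlim : ∀ A : Set X, ∃ c, Tendsto (fun i => ν i A) U (nhds c) := fun A =>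
    ⟨_, (U.map fun i => ν i A).le_nhds_lim⟩
  choose m hm using hlim
  have hm_le : ∀ A, m A ≤ μ A := fun A => le_of_tendsto' (hm A) fun i => hν i A
  have hm_iUnion : ∀ ⦃f : ℕ → Set X⦄, (∀ i, MeasurableSet (f i)) →
      Pairwise (Function.onFun Disjoint f) → m (⋃ i, f i) = ∑' i, m (f i) := by
    intro f hf hd
    have hd' : ∀ n, Pairwise (Function.onFun Disjoint fun k => f (k + n)) := fun n i j hij =>
      hd (by omega)
    have hsplit : ∀ n, m (⋃ i, f i) =
        ∑ i ∈ Finset.range n, m (f i) + m (⋃ k, f (k + n)) := by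
      intro n
      refine tendsto_nhds_unique (hm _)
        (((tendsto_finsetSum (Finset.range n) fun i _ => hm (f i)).add
          (hm (⋃ k, f (k + n)))).congr fun i => ?_)
      rw [measure_iUnion hd hf, measure_iUnion (hd' n) fun k => hf _]
      exact ENNReal.summable.sum_add_tsum_nat_add'
    have htail : Tendsto (fun n => m (⋃ k, f (k + n))) atTop (nhds 0) := by
      refine tendsto_of_tendsto_of_tendsto_of_le_of_le tendsto_const_nhds
        (ENNReal.tendsto_sum_nat_add (fun i => μ (f i)) ?_) (fun _ => zero_le) fun n => ?_
      · rw [← measure_iUnion hd hf]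
        exact measure_ne_top _ _
      · exact (hm_le _).trans (measure_iUnion_le _)
    have hsum := (ENNReal.summable (f := fun i => m (f i))).hasSum.tendsto_sum_nat.add htail
    rw [add_zero] at hsum
    exact tendsto_nhds_unique (tendsto_const_nhds.congr hsplit) hsum
  have hm_empty : m ∅ = 0 := nonpos_iff_eq_zero.mp ((hm_le ∅).trans_eq measure_empty)
  refine ⟨Measure.ofMeasurable (fun A _ => m A) hm_empty hm_iUnion, fun A hA => ?_⟩
  rw [Measure.ofMeasurable_apply A hA]
  exact hm A

/-- If `ν ≤ μ` is nonzero, then `μ` is absolutely continuous with respect to `ν` on some set of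
positive `μ`-measure. -/
theorem exists_pos_forall_subset_pos {X : Type*} [MeasurableSpace X] (μ ν : Measure X)
    [IsFiniteMeasure μ] [IsFiniteMeasure ν] (hle : ν ≤ μ) (hν : 0 < ν univ) :
    ∃ E, MeasurableSet E ∧ 0 < μ E ∧ ∀ A ⊆ E, 0 < μ A → 0 < ν A := by
  have hs := Measure.mutuallySingular_singularPart μ ν
  refine ⟨hs.nullSet, hs.measurableSet_nullSet, ?_, fun A hA hμA => ?_⟩
  · refine lt_of_lt_of_le ?_ (hle _)
    rwa [← measure_add_measure_compl hs.measurableSet_nullSet, hs.measure_compl_nullSet,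
      add_zero] at hν
  · rw [pos_iff_ne_zero]
    intro hνA
    refine hμA.ne' ?_
    rw [Measure.haveLebesgueDecomposition_add μ ν, Measure.add_apply,
      measure_mono_null hA hs.measure_nullSet,
      withDensity_absolutelyContinuous ν (μ.rnDeriv ν) hνA, add_zero]

/-- The atom of the algebra generated by `s` consisting of the points that lie in exactly those
members of `s` that belong to `t`. -/
def generatedCell {X : Type*} (s t : Finset (Set X)) : Set X :=
  {x | ∀ S ∈ s, x ∈ S ↔ S ∈ t}

/-- The partition generated by a finite family `s` of sets. -/
def generatedPartition {X : Type*} (s : Finset (Set X)) : Set (Set X) :=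
  generatedCell s '' (s.powerset : Set (Finset (Set X)))

theorem measurableSet_generatedCell {X : Type*} [MeasurableSpace X] {s : Finset (Set X)}
    (hs : ∀ S ∈ s, MeasurableSet S) (t : Finset (Set X)) :
    MeasurableSet (generatedCell s t) := by
  have : generatedCell s t = ⋂ S ∈ s, {x | x ∈ S ↔ S ∈ t} := by
    ext x
    simp [generatedCell]
  rw [this]
  exact Finset.measurableSet_biInter s fun S hS => (hs S hS).iff (MeasurableSet.const _)

theorem isFinitePartition_generatedPartition {X : Type*} [MeasurableSpace X]
    {s : Finset (Set X)} (hs : ∀ S ∈ s, MeasurableSet S) :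
    IsFinitePartition (generatedPartition s) := by
  classical
  refine ⟨s.powerset.finite_toSet.image _, ?_, ?_, ?_⟩
  · rintro _ ⟨t, -, rfl⟩
    exact measurableSet_generatedCell hs t
  · rintro _ ⟨t, -, rfl⟩ _ ⟨t', -, rfl⟩ hne
    rw [Set.disjoint_left]
    intro x hx hx'
    refine hne (Set.ext fun y => forall₂_congr fun S hS => ?_)
    rw [← hx S hS, ← hx' S hS]
  · refine Set.eq_univ_of_forall fun x => ⟨_, ⟨s.filter (x ∈ ·), ?_, rfl⟩, ?_⟩
    · exact Finset.mem_coe.2 (Finset.mem_powerset.2 (Finset.filter_subset _ _))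
    · intro S hS
      simp [hS]

theorem subset_of_mem_generatedPartition {X : Type*} {s : Finset (Set X)} {A B : Set X}
    (hA : A ∈ s) (hB : B ∈ generatedPartition s) (hAB : (A ∩ B).Nonempty) : B ⊆ A := by
  obtain ⟨t, -, rfl⟩ := hB
  obtain ⟨x, hxA, hxB⟩ := hAB
  exact fun y hy => (hy A hA).2 ((hxB A hA).1 hxA)

/-- A set that charges the boundary of `C`, for a partition refining it, is split by `C`. -/
theorem split_of_measure_inter_piBoundary_pos {X : Type*} [MeasurableSpace X] {μ : Measure X}
    {s : Finset (Set X)} {A C : Set X} (hA : A ∈ s)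
    (h : 0 < μ (A ∩ piBoundary μ (generatedPartition s) C)) :
    0 < μ (A ∩ C) ∧ 0 < μ (A ∩ Cᶜ) := by
  obtain ⟨x, hxA, B, ⟨hB, hpos⟩, hxB⟩ := nonempty_of_measure_ne_zero h.ne'
  have hBA := subset_of_mem_generatedPartition hA hB ⟨x, hxA, hxB⟩
  rw [pos_iff_ne_zero, mul_ne_zero_iff] at hpos
  exact ⟨(pos_iff_ne_zero.2 hpos.1).trans_le (measure_mono (inter_subset_inter_left _ hBA)),
    (pos_iff_ne_zero.2 hpos.2).trans_le (measure_mono (inter_subset_inter_left _ hBA))⟩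

/-- If `𝒞` is not finitely approximable, then there is a set `E` of positive measure such that
any finitely many non-null measurable subsets of `E` are simultaneously split by a member
of `𝒞`. -/
theorem exists_simultaneous_split {X : Type*} [MeasurableSpace X] (μ : Measure X)
    [IsFiniteMeasure μ] (𝒞 : Set (Set X)) (h : ¬ FinitelyApproximable μ 𝒞) :
    ∃ E, MeasurableSet E ∧ 0 < μ E ∧ ∀ 𝒜 : Set (Set X), 𝒜.Finite →
      (∀ A ∈ 𝒜, MeasurableSet A ∧ A ⊆ E ∧ 0 < μ A) →
      ∃ C ∈ 𝒞, ∀ A ∈ 𝒜, 0 < μ (A ∩ C) ∧ 0 < μ (A ∩ Cᶜ) := by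
  classical
  unfold FinitelyApproximable at h
  push Not at h
  obtain ⟨ε, hε, h⟩ := h
  let sets : Finset {S : Set X // MeasurableSet S} → Finset (Set X) := fun s =>
    s.image Subtype.val
  have hsets : ∀ s, ∀ S ∈ sets s, MeasurableSet S := by
    intro s S hS
    obtain ⟨S, -, rfl⟩ := Finset.mem_image.1 hS
    exact S.2
  choose C hC hCε using fun s => h _ (isFinitePartition_generatedPartition (hsets s))
  let U : Ultrafilter (Finset {S : Set X // MeasurableSet S}) := Ultrafilter.of atTop
  let G s := piBoundary μ (generatedPartition (sets s)) (C s)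
  obtain ⟨ρ, hρ⟩ := exists_measure_tendsto_ultrafilter U μ (fun s => μ.restrict (G s))
    fun s => Measure.restrict_le_self
  have hρμ : ρ ≤ μ := Measure.le_iff.2 fun A hA =>
    le_of_tendsto' (hρ A hA) fun s => Measure.restrict_le_self A
  have : IsFiniteMeasure ρ := isFiniteMeasure_of_le μ hρμ
  have hρ_univ : 0 < ρ univ := by
    refine hε.trans_le (ge_of_tendsto' (hρ univ MeasurableSet.univ) fun s => ?_)
    rw [Measure.restrict_apply_univ]
    exact (hCε s).le
  obtain ⟨E, hE, hμE, hpos⟩ := exists_pos_forall_subset_pos μ ρ hρμ hρ_univ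
  refine ⟨E, hE, hμE, fun 𝒜 hfin h𝒜 => ?_⟩
  have hev : ∀ᶠ s in (U : Filter (Finset {S : Set X // MeasurableSet S})),
        ∀ A ∈ 𝒜, 0 < μ (A ∩ C s) ∧ 0 < μ (A ∩ (C s)ᶜ) := by
    refine (Filter.eventually_all_finite hfin).2 fun A hA => ?_
    obtain ⟨hAm, hAE, hAμ⟩ := h𝒜 A hA
    have hmem : ∀ᶠ s in (U : Filter (Finset {S : Set X // MeasurableSet S})),
        {(⟨A, hAm⟩ : {S : Set X // MeasurableSet S})} ≤ s :=
      Ultrafilter.of_le atTop (eventually_ge_atTop _)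
    filter_upwards [hmem, (hρ A hAm).eventually_const_lt (hpos A hAE hAμ)] with s hs hlt
    rw [Measure.restrict_apply hAm] at hlt
    exact split_of_measure_inter_piBoundary_pos
      (Finset.mem_image.2 ⟨_, Finset.singleton_subset_iff.1 hs, rfl⟩) hlt
  obtain ⟨s, hs⟩ := hev.exists
  exact ⟨C s, hC s, hs⟩

/-- A family of measurable sets that is not finitely approximable contains Boolean independent
subfamilies of every finite size. -/
theorem exists_independent_of_not_finitelyApproximable {X : Type*} [MeasurableSpace X]
    (μ : Measure X) [IsFiniteMeasure μ] (𝒞 : Set (Set X)) (h𝒞 : ∀ C ∈ 𝒞, MeasurableSet C)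
    (h : ¬ FinitelyApproximable μ 𝒞) (n : ℕ) :
    ∃ C : Fin n → Set X, (∀ i, C i ∈ 𝒞) ∧
      ∀ t : Set (Fin n), {x | ∀ i, x ∈ C i ↔ i ∈ t}.Nonempty := by
  obtain ⟨E, hE, hμE, hsplit⟩ := exists_simultaneous_split μ 𝒞 h
  suffices ∃ C : Fin n → Set X, (∀ i, C i ∈ 𝒞) ∧
      ∀ t : Set (Fin n), 0 < μ (E ∩ {x | ∀ i, x ∈ C i ↔ i ∈ t}) by
    obtain ⟨C, hC, hpos⟩ := this
    exact ⟨C, hC, fun t =>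
      (nonempty_of_measure_ne_zero (hpos t).ne').mono inter_subset_right⟩
  induction n with
  | zero => exact ⟨Fin.elim0, fun i => i.elim0, fun t => by simpa using hμE⟩
  | succ n ih =>
    obtain ⟨C, hC, hpos⟩ := ih
    obtain ⟨D, hD, hDsplit⟩ := hsplit
      (range fun t : Set (Fin n) => E ∩ {x | ∀ i, x ∈ C i ↔ i ∈ t}) (Set.finite_range _) (by
        rintro _ ⟨t, rfl⟩
        refine ⟨hE.inter ?_, inter_subset_left, hpos t⟩
        rw [ofPred_forall]
        exact MeasurableSet.iInter fun i => (h𝒞 _ (hC i)).iff (MeasurableSet.const _))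
    refine ⟨Fin.cons D C, Fin.cases hD hC, fun t => ?_⟩
    obtain ⟨h_in, h_out⟩ := hDsplit _ ⟨{i | i.succ ∈ t}, rfl⟩
    by_cases h0 : (0 : Fin (n + 1)) ∈ t
    · refine h_in.trans_le (measure_mono ?_)
      rintro x ⟨⟨hxE, hx⟩, hxD⟩
      exact ⟨hxE, Fin.forall_fin_succ.2 ⟨iff_of_true hxD h0, hx⟩⟩
    · refine h_out.trans_le (measure_mono ?_)
      rintro x ⟨⟨hxE, hx⟩, hxD⟩
      exact ⟨hxE, Fin.forall_fin_succ.2 ⟨iff_of_false hxD h0, hx⟩⟩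

/-- A Boolean independent family indexed by the subsets of a `k`-element set yields a shattered
set with `k` elements. -/
theorem exists_shatters_of_independent {X : Type*} {𝒞 : Set (Set X)} {k : ℕ}
    (C : Set (Fin k) → Set X) (hC : ∀ S, C S ∈ 𝒞)
    (hind : ∀ t : Set (Set (Fin k)), {x | ∀ S, x ∈ C S ↔ S ∈ t}.Nonempty) :
    ∃ D : Finset X, Shatters 𝒞 D ∧ D.card = k := by
  classical
  choose x hx using fun j : Fin k => hind {S | j ∈ S}
  have hx' : ∀ j S, x j ∈ C S ↔ j ∈ S := fun j S => hx j S
  have hinj : Function.Injective x := fun i j hij => by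
    have := (hx' i {j}).1 (hij ▸ (hx' j {j}).2 rfl)
    exact this
  refine ⟨Finset.univ.image x, fun B _ => ⟨C {j | x j ∈ B}, hC _, fun y hy => ?_⟩, ?_⟩
  · obtain ⟨j, -, rfl⟩ := Finset.mem_image.1 hy
    exact hx' j _
  · rw [Finset.card_image_of_injective _ hinj, Finset.card_univ, Fintype.card_fin]

/-- **Theorem 1.** For any family `𝒞` of measurable sets in a probability space, either `𝒞` is
finitely approximable, or `𝒞` has infinite VC dimension. -/
theorem finitelyApproximable_or_infinite_vc {X : Type*} [MeasurableSpace X]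
    (μ : Measure X) [IsProbabilityMeasure μ] (𝒞 : Set (Set X))
    (h𝒞 : ∀ C ∈ 𝒞, MeasurableSet C) :
    FinitelyApproximable μ 𝒞 ∨ ¬ FiniteVC 𝒞 := by
  refine or_iff_not_imp_left.2 fun h => ?_
  rintro ⟨k, hk⟩
  let e := Finite.equivFin (Set (Fin (k + 1)))
  obtain ⟨C, hC, hind⟩ := exists_independent_of_not_finitelyApproximable μ 𝒞 h𝒞 h
    (Nat.card (Set (Fin (k + 1))))
  obtain ⟨D, hD, hcard⟩ := exists_shatters_of_independent (fun S => C (e S)) (fun S => hC _)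
    fun t => (hind (e.symm ⁻¹' t)).mono fun x hx S => by simpa using hx (e S)
  have := hk D hD
  omega
end

section
/- Let (𝒳, 𝒮, μ) be a probability space and let 𝒞 ⊆ 𝒮 be a separable family of sets with finite VC dimension. Then the bracketing number N_[](ε, 𝒞, μ) is finite for every ε > 0. -/
open MeasureTheory Set Filter

/-- A family of sets is separable if some countable subfamily `𝒞₀ ⊆ 𝒞` is pointwise dense:
every `C ∈ 𝒞` is a pointwise limit (of indicator functions) of a sequence from `𝒞₀`. -/
def SeparableSetFamily {X : Type*} (𝒞 : Set (Set X)) : Prop :=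
  ∃ 𝒞₀ ⊆ 𝒞, 𝒞₀.Countable ∧ ∀ C ∈ 𝒞, ∃ g : ℕ → Set X, (∀ n, g n ∈ 𝒞₀) ∧
    ∀ x : X, ∀ᶠ n in Filter.atTop, (x ∈ g n ↔ x ∈ C)

/-- The family `ℱ` of real functions has finite bracketing numbers w.r.t. `μ`: for every
`ε > 0` finitely many `ε`-brackets (pairs of measurable functions `g ≤ h` with
`∫ (h - g) dμ ≤ ε`) cover `ℱ`. -/
def FiniteBracketing {X : Type*} [MeasurableSpace X] (μ : Measure X)
    (ℱ : Set (X → ℝ)) : Prop :=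
  ∀ ε : ℝ, 0 < ε → ∃ n : ℕ, ∃ g h : Fin n → X → ℝ,
    (∀ i, Measurable (g i) ∧ Measurable (h i) ∧ (∀ x, g i x ≤ h i x) ∧
      ∫⁻ x, ENNReal.ofReal (h i x - g i x) ∂μ ≤ ENNReal.ofReal ε) ∧
    ∀ f ∈ ℱ, ∃ i, ∀ x, g i x ≤ f x ∧ f x ≤ h i x

/-- The points on which the members of `U` do not all agree. -/
def disagreement {X : Type*} (U : Set (Set X)) : Set X := ⋃₀ U \ ⋂₀ U

theorem disagreement_mono {X : Type*} {U V : Set (Set X)} (h : U ⊆ V) :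
    disagreement U ⊆ disagreement V :=
  sdiff_subset_sdiff (sUnion_subset_sUnion h) (sInter_subset_sInter h)

theorem measurableSet_disagreement {X : Type*} [MeasurableSpace X] {U : Set (Set X)}
    (hU : U.Countable) (hm : ∀ C ∈ U, MeasurableSet C) : MeasurableSet (disagreement U) :=
  (MeasurableSet.sUnion hU hm).diff (MeasurableSet.sInter hU hm)

/-- `U` is contained in a finite union of subfamilies of `𝒞` whose disagreement sets have measure
at most `ε`. -/
def FinitelyCovered {X : Type*} [MeasurableSpace X] (μ : Measure X) (𝒞 : Set (Set X))
    (ε : ENNReal) (U : Set (Set X)) : Prop :=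
  ∃ 𝒱 : Set (Set (Set X)), 𝒱.Finite ∧ U ⊆ ⋃₀ 𝒱 ∧
    ∀ V ∈ 𝒱, V ⊆ 𝒞 ∧ μ (disagreement V) ≤ ε

theorem FinitelyCovered.mono {X : Type*} [MeasurableSpace X] {μ : Measure X} {𝒞 : Set (Set X)}
    {ε : ENNReal} {U V : Set (Set X)} (hV : FinitelyCovered μ 𝒞 ε V) (h : U ⊆ V) :
    FinitelyCovered μ 𝒞 ε U := by
  obtain ⟨𝒱, hfin, hcov, h𝒱⟩ := hV
  exact ⟨𝒱, hfin, h.trans hcov, h𝒱⟩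

theorem FinitelyCovered.union {X : Type*} [MeasurableSpace X] {μ : Measure X} {𝒞 : Set (Set X)}
    {ε : ENNReal} {U V : Set (Set X)} (hU : FinitelyCovered μ 𝒞 ε U)
    (hV : FinitelyCovered μ 𝒞 ε V) : FinitelyCovered μ 𝒞 ε (U ∪ V) := by
  obtain ⟨𝒱, hfin, hcov, h𝒱⟩ := hU
  obtain ⟨𝒲, hfin', hcov', h𝒲⟩ := hV
  refine ⟨𝒱 ∪ 𝒲, hfin.union hfin', ?_, ?_⟩
  · rw [sUnion_union]
    exact union_subset_union hcov hcov'
  · rintro W (hW | hW)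
    exacts [h𝒱 W hW, h𝒲 W hW]

theorem finitelyCovered_empty {X : Type*} [MeasurableSpace X] (μ : Measure X) (𝒞 : Set (Set X))
    (ε : ENNReal) : FinitelyCovered μ 𝒞 ε ∅ :=
  ⟨∅, finite_empty, empty_subset _, by simp⟩

/-- If `𝒞` is not finitely covered, some ultrafilter on `𝒞` contains only families with
disagreement set of measure more than `ε`. -/
theorem exists_ultrafilter_of_not_finitelyCovered {X : Type*} [MeasurableSpace X]
    {μ : Measure X} {𝒞 : Set (Set X)} {ε : ENNReal} (h : ¬ FinitelyCovered μ 𝒞 ε 𝒞) :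
    ∃ 𝒰 : Ultrafilter (Set X), 𝒞 ∈ 𝒰 ∧ ∀ U ∈ 𝒰, U ⊆ 𝒞 → ε < μ (disagreement U) := by
  let l : Filter (Set X) := Filter.comk (fun U => FinitelyCovered μ 𝒞 ε (U ∩ 𝒞))
    (by simpa using finitelyCovered_empty μ 𝒞 ε)
    (fun t ht s hst => ht.mono (inter_subset_inter_left _ hst))
    (fun s hs t ht => by
      rw [union_inter_distrib_right]
      exact hs.union ht)
  have mem_l : ∀ V, V ∈ l ↔ FinitelyCovered μ 𝒞 ε (Vᶜ ∩ 𝒞) := fun V => Iff.rfl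
  have hne : l.NeBot := by
    refine ⟨fun hbot => h ?_⟩
    have : (∅ : Set (Set X)) ∈ l := by simp [hbot]
    simpa [mem_l] using this
  refine ⟨Ultrafilter.of l, Ultrafilter.of_le l ?_, fun U hU hUC => ?_⟩
  · simpa [mem_l] using finitelyCovered_empty μ 𝒞 ε
  · by_contra! hle
    have hc : Uᶜ ∈ l := by
      rw [mem_l, compl_compl]
      exact ⟨{U}, finite_singleton U, by simp, by simpa using ⟨hUC, hle⟩⟩
    exact Ultrafilter.compl_notMem_iff.mpr hU (Ultrafilter.of_le l hc)

/-- A downward directed family of measurable sets with measures bounded below has an almost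
everywhere lower bound of positive measure. -/
theorem exists_ae_lower_bound {X ι : Type*} [MeasurableSpace X] (μ : Measure X)
    [IsFiniteMeasure μ] [Nonempty ι] (f : ι → Set X) (hf : ∀ i, MeasurableSet (f i))
    (hdir : Directed (· ⊇ ·) f) {ε : ENNReal} (hε : 0 < ε) (hlow : ∀ i, ε ≤ μ (f i)) :
    ∃ S, 0 < μ S ∧ ∀ i, μ (S \ f i) = 0 := by
  obtain ⟨u, -, hu, hmem⟩ := exists_seq_tendsto_sInf (range_nonempty fun i => μ (f i))
    (OrderBot.bddBelow _)
  choose v hv using hmem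
  set m := sInf (range fun i => μ (f i)) with hm
  have hmle : ∀ i, m ≤ μ (f i) := fun i => sInf_le (mem_range_self i)
  have hεm : ε ≤ m := le_sInf (by rintro _ ⟨i, rfl⟩; exact hlow i)
  have hdir' : ∀ n, ∃ i, ∀ k ≤ n, f i ⊆ f (v k) := by
    intro n
    induction n with
    | zero => exact ⟨v 0, fun k hk => by rw [Nat.le_zero.mp hk]⟩
    | succ n ih =>
      obtain ⟨i, hi⟩ := ih
      obtain ⟨j, hj, hj'⟩ := hdir i (v (n + 1))
      refine ⟨j, fun k hk => ?_⟩
      rcases Nat.le_succ_iff.mp hk with hk | rfl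
      exacts [Subset.trans hj (hi k hk), hj']
  refine ⟨⋂ n, f (v n), ?_, fun i => ?_⟩
  · refine hε.trans_le ?_
    rw [measure_iInter_eq_iInf_measure_iInter_le (fun n => (hf _).nullMeasurableSet)
      ⟨0, measure_ne_top _ _⟩]
    refine le_iInf fun n => ?_
    obtain ⟨j, hj⟩ := hdir' n
    exact (hlow j).trans (measure_mono (subset_iInter₂ hj))
  · have hmtop : m ≠ ⊤ := ((hmle i).trans_lt (measure_lt_top μ _)).ne
    have hbound : ∀ n, μ ((⋂ n, f (v n)) \ f i) ≤ u n - m := by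
      intro n
      obtain ⟨j, hj, hj'⟩ := hdir (v n) i
      calc μ ((⋂ n, f (v n)) \ f i) ≤ μ (f (v n) \ f j) :=
            measure_mono (sdiff_subset_sdiff (iInter_subset _ n) hj')
        _ = μ (f (v n)) - μ (f j) :=
            measure_sdiff hj (hf j).nullMeasurableSet (measure_ne_top _ _)
        _ ≤ u n - m := by
            rw [← hv n]
            exact tsub_le_tsub_left (hmle j) _
    have hlim : Tendsto (fun n => u n - m) atTop (nhds 0) := by
      simpa using ENNReal.Tendsto.sub hu (tendsto_const_nhds (x := m)) (Or.inl hmtop)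
    exact le_antisymm (ge_of_tendsto' hlim hbound) zero_le

/-- If `S` is almost everywhere contained in all disagreement sets along `𝒰`, then `𝒰`-almost
every set splits a given non-null subset of `S` into two non-null pieces. -/
theorem eventually_splits {X : Type*} [MeasurableSpace X] {μ : Measure X} {𝒞 : Set (Set X)}
    (hc : 𝒞.Countable) {𝒰 : Ultrafilter (Set X)} (h𝒰 : 𝒞 ∈ 𝒰) {S A : Set X}
    (hS : ∀ U ∈ 𝒰, U ⊆ 𝒞 → μ (S \ disagreement U) = 0) (hAS : A ⊆ S) (hA : 0 < μ A) :
    ∀ᶠ D in (𝒰 : Filter (Set X)), 0 < μ (A ∩ D) ∧ 0 < μ (A \ D) := by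
  have key : ∀ p : Set X → Set X,
      (∀ U ⊆ 𝒞, A ∩ disagreement U ⊆ ⋃ D ∈ U, p D) →
        ∀ᶠ D in (𝒰 : Filter (Set X)), 0 < μ (p D) := by
    intro p hp
    by_contra hcon
    rw [← Ultrafilter.eventually_not] at hcon
    set U : Set (Set X) := {D | ¬ 0 < μ (p D)} ∩ 𝒞 with hUdef
    have hU : U ∈ 𝒰 := inter_mem hcon h𝒰
    have hUC : U ⊆ 𝒞 := inter_subset_right
    have hnull : μ (⋃ D ∈ U, p D) = 0 :=
      (measure_biUnion_null_iff (hc.mono hUC)).mpr fun D hD => by simpa using hD.1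
    refine hA.ne' (measure_mono_null ?_ (measure_union_null hnull (hS U hU hUC)))
    intro x hx
    by_cases hxU : x ∈ disagreement U
    · exact Or.inl (hp U hUC ⟨hx, hxU⟩)
    · exact Or.inr ⟨hAS hx, hxU⟩
  refine (key (A ∩ ·) ?_).and (key (A \ ·) ?_)
  · rintro U - x ⟨hx, ⟨D, hD, hxD⟩, -⟩
    exact mem_biUnion hD ⟨hx, hxD⟩
  · rintro U - x ⟨hx, -, hxU⟩
    simp only [mem_sInter, not_forall] at hxU
    obtain ⟨D, hD, hxD⟩ := hxU
    exact mem_biUnion hD ⟨hx, hxD⟩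

/-- Repeated splitting produces Boolean independent families of any finite length. -/
theorem exists_independent_of_splits {X : Type*} [MeasurableSpace X] {μ : Measure X}
    {𝒞 : Set (Set X)} {l : Filter (Set X)} [l.NeBot] (hl : 𝒞 ∈ l) {S : Set X} (hS : 0 < μ S)
    (hsplit : ∀ A ⊆ S, 0 < μ A → ∀ᶠ D in l, 0 < μ (A ∩ D) ∧ 0 < μ (A \ D)) (n : ℕ) :
    ∃ D : ℕ → Set X, (∀ i < n, D i ∈ 𝒞) ∧
      ∀ T ⊆ Finset.range n, 0 < μ (S ∩ {x | ∀ i < n, x ∈ D i ↔ i ∈ T}) := by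
  induction n with
  | zero => exact ⟨fun _ => ∅, by simp, fun T _ => by simpa using hS⟩
  | succ n ih =>
    obtain ⟨D, hD, hcell⟩ := ih
    have hev : ∀ᶠ E in l, ∀ T ∈ (Finset.range n).powerset,
        0 < μ ((S ∩ {x | ∀ i < n, x ∈ D i ↔ i ∈ T}) ∩ E) ∧
        0 < μ ((S ∩ {x | ∀ i < n, x ∈ D i ↔ i ∈ T}) \ E) :=
      (Filter.eventually_all_finset _).mpr fun T hT =>
        hsplit _ inter_subset_left (hcell T (Finset.mem_powerset.mp hT))
    obtain ⟨E, hE, hEC⟩ := (hev.and hl).exists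
    refine ⟨Function.update D n E, fun i hi => ?_, fun T hT => ?_⟩
    · rcases Nat.lt_succ_iff_lt_or_eq.mp hi with hi | rfl
      · rw [Function.update_of_ne hi.ne]
        exact hD i hi
      · rwa [Function.update_self]
    · have hTn : T.erase n ⊆ Finset.range n := by
        intro i hi
        have := hT (Finset.mem_of_mem_erase hi)
        have := Finset.ne_of_mem_erase hi
        simp only [Finset.mem_range] at *
        omega
      have hext : ∀ x, (∀ i < n, x ∈ D i ↔ i ∈ T.erase n) → (x ∈ E ↔ n ∈ T) →
          ∀ i < n + 1, x ∈ Function.update D n E i ↔ i ∈ T := by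
        intro x hx hxE i hi
        rcases Nat.lt_succ_iff_lt_or_eq.mp hi with hi | rfl
        · rw [Function.update_of_ne hi.ne, hx i hi]
          simp [hi.ne]
        · simpa using hxE
      obtain ⟨hin, hout⟩ := hE _ (Finset.mem_powerset.mpr hTn)
      by_cases hnT : n ∈ T
      · refine hin.trans_le (measure_mono ?_)
        rintro x ⟨⟨hxS, hx⟩, hxE⟩
        exact ⟨hxS, hext x hx (iff_of_true hxE hnT)⟩
      · refine hout.trans_le (measure_mono ?_)
        rintro x ⟨⟨hxS, hx⟩, hxE⟩
        exact ⟨hxS, hext x hx (iff_of_false hxE hnT)⟩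

/-- A family containing Boolean independent subfamilies of every finite length has infinite
VC dimension. -/
theorem not_finiteVC_of_independent {X : Type*} {𝒞 : Set (Set X)}
    (h : ∀ n : ℕ, ∃ D : ℕ → Set X, (∀ i < n, D i ∈ 𝒞) ∧
      ∀ T ⊆ Finset.range n, ∃ x, ∀ i < n, x ∈ D i ↔ i ∈ T) : ¬ FiniteVC 𝒞 := by
  classical
  rintro ⟨k, hk⟩
  let e := Fintype.equivFin (Finset (Fin (k + 1)))
  obtain ⟨D, hD, hcell⟩ := h (Fintype.card (Finset (Fin (k + 1))))
  have hx : ∀ j : Fin (k + 1), ∃ x, ∀ B : Finset (Fin (k + 1)), x ∈ D (e B) ↔ j ∈ B := by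
    intro j
    obtain ⟨x, hx⟩ := hcell
      ((Finset.univ.filter fun B : Finset (Fin (k + 1)) => j ∈ B).image fun B => (e B : ℕ)) (by
        intro i hi
        obtain ⟨B, -, rfl⟩ := Finset.mem_image.mp hi
        exact Finset.mem_range.mpr (e B).isLt)
    refine ⟨x, fun B => ?_⟩
    rw [hx _ (e B).isLt]
    simp [Fin.val_inj]
  choose x hx using hx
  have hinj : Function.Injective x := by
    intro i j hij
    have hi := hx i {j}
    rw [hij, hx j {j}] at hi
    simpa using hi
  have hcard := hk (Finset.univ.image x) fun B _ => by
    refine ⟨D (e (Finset.univ.filter fun j => x j ∈ B)), hD _ (e _).isLt, ?_⟩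
    intro y hy
    obtain ⟨j, -, rfl⟩ := Finset.mem_image.mp hy
    simp [hx]
  rw [Finset.card_image_of_injective _ hinj, Finset.card_univ, Fintype.card_fin] at hcard
  omega

theorem finitelyCovered_of_finiteVC {X : Type*} [MeasurableSpace X] (μ : Measure X)
    [IsFiniteMeasure μ] {𝒞 : Set (Set X)} (hc : 𝒞.Countable) (hm : ∀ C ∈ 𝒞, MeasurableSet C)
    (hVC : FiniteVC 𝒞) {ε : ENNReal} (hε : 0 < ε) : FinitelyCovered μ 𝒞 ε 𝒞 := by
  by_contra hcon
  obtain ⟨𝒰, h𝒰, hlow⟩ := exists_ultrafilter_of_not_finitelyCovered hcon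
  let ι := {U : Set (Set X) // U ∈ 𝒰 ∧ U ⊆ 𝒞}
  have : Nonempty ι := ⟨⟨𝒞, h𝒰, Subset.rfl⟩⟩
  obtain ⟨S, hSpos, hS⟩ := exists_ae_lower_bound μ (fun U : ι => disagreement U.1)
    (fun U => measurableSet_disagreement (hc.mono U.2.2) fun C hC => hm C (U.2.2 hC))
    (fun U V => ⟨⟨U.1 ∩ V.1, inter_mem U.2.1 V.2.1, inter_subset_left.trans U.2.2⟩,
      disagreement_mono inter_subset_left, disagreement_mono inter_subset_right⟩)
    hε (fun U => (hlow U.1 U.2.1 U.2.2).le)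
  refine not_finiteVC_of_independent (fun n => ?_) hVC
  obtain ⟨D, hD, hcell⟩ := exists_independent_of_splits (μ := μ) h𝒰 hSpos
    (fun A hAS hA => eventually_splits hc h𝒰 (fun U hU hUC => hS ⟨U, hU, hUC⟩) hAS hA) n
  refine ⟨D, hD, fun T hT => ?_⟩
  obtain ⟨x, -, hx⟩ := nonempty_of_measure_ne_zero (hcell T hT).ne'
  exact ⟨x, hx⟩

theorem FiniteVC.mono {X : Type*} {𝒞 𝒟 : Set (Set X)} (h : FiniteVC 𝒟) (hsub : 𝒞 ⊆ 𝒟) :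
    FiniteVC 𝒞 := by
  obtain ⟨k, hk⟩ := h
  refine ⟨k, fun D hD => hk D fun B hB => ?_⟩
  obtain ⟨C, hC, hCB⟩ := hD B hB
  exact ⟨C, hsub hC, hCB⟩

/-- **Corollary 1.** A separable VC class of measurable sets has finite bracketing numbers
(brackets taken with respect to indicator functions). -/
theorem separable_vc_finite_bracketing {X : Type*} [MeasurableSpace X]
    (μ : Measure X) [IsProbabilityMeasure μ] (𝒞 : Set (Set X))
    (h𝒞 : ∀ C ∈ 𝒞, MeasurableSet C) (hsep : SeparableSetFamily 𝒞) (hVC : FiniteVC 𝒞) :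
    FiniteBracketing μ ((fun C => Set.indicator C (fun _ => (1 : ℝ))) '' 𝒞) := by
  intro ε hε
  obtain ⟨𝒞₀, hsub, hc, hdense⟩ := hsep
  have hm : ∀ C ∈ 𝒞₀, MeasurableSet C := fun C hC => h𝒞 C (hsub hC)
  obtain ⟨𝒱, hfin, hcov, h𝒱⟩ := finitelyCovered_of_finiteVC μ hc hm (hVC.mono hsub)
    (ENNReal.ofReal_pos.mpr hε)
  have : Finite 𝒱 := hfin
  obtain ⟨n, ⟨e⟩⟩ := Finite.exists_equiv_fin 𝒱
  -- intersecting with the union makes the lower bracket of the empty family zero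
  refine ⟨n, fun i => (⋂₀ (e.symm i).1 ∩ ⋃₀ (e.symm i).1).indicator fun _ => 1,
    fun i => (⋃₀ (e.symm i).1).indicator fun _ => 1, fun i => ?_, ?_⟩
  · obtain ⟨hV, hμ⟩ := h𝒱 _ (e.symm i).2
    have hVc := hc.mono hV
    have hVm : ∀ C ∈ (e.symm i).1, MeasurableSet C := fun C hC => hm C (hV hC)
    have hU := MeasurableSet.sUnion hVc hVm
    refine ⟨measurable_const.indicator ((MeasurableSet.sInter hVc hVm).inter hU),
      measurable_const.indicator hU, ?_, ?_⟩
    · exact indicator_le_indicator_of_subset inter_subset_right fun _ => zero_le_one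
    · refine le_trans (le_of_eq ?_) hμ
      rw [← lintegral_indicator_one (measurableSet_disagreement hVc hVm)]
      refine lintegral_congr fun x => ?_
      by_cases h1 : x ∈ ⋃₀ (e.symm i).1 <;> by_cases h2 : x ∈ ⋂₀ (e.symm i).1 <;>
        simp only [disagreement, indicator, mem_inter_iff, Set.mem_sdiff, h1, h2] <;> simp
  · rintro _ ⟨C, hC, rfl⟩
    obtain ⟨s, hs, hlim⟩ := hdense C hC
    have hfreq : ∃ V ∈ 𝒱, ∃ᶠ k in atTop, s k ∈ V := by
      by_contra! hcon
      have hev : ∀ᶠ k in atTop, ∀ V ∈ 𝒱, s k ∉ V :=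
        (Filter.eventually_all_finite hfin).mpr fun V hV => by simpa using hcon V hV
      obtain ⟨k, hk⟩ := hev.exists
      obtain ⟨V, hV, hkV⟩ := hcov (hs k)
      exact hk V hV hkV
    obtain ⟨V, hV, hfr⟩ := hfreq
    refine ⟨e ⟨V, hV⟩, fun x => ?_⟩
    obtain ⟨k, hkV, hkx⟩ := (hfr.and_eventually (hlim x)).exists
    simp only [Equiv.symm_apply_apply]
    have hlow : x ∈ ⋂₀ V ∩ ⋃₀ V → x ∈ C := fun hx => hkx.mp (hx.1 _ hkV)
    have hup : x ∈ C → x ∈ ⋃₀ V := fun hx => ⟨s k, hkV, hkx.mpr hx⟩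
    constructor
    · by_cases hx : x ∈ ⋂₀ V ∩ ⋃₀ V
      · rw [indicator_of_mem hx, indicator_of_mem (hlow hx)]
      · rw [indicator_of_notMem hx]
        exact indicator_nonneg (fun _ _ => zero_le_one) x
    · by_cases hx : x ∈ C
      · rw [indicator_of_mem hx, indicator_of_mem (hup hx)]
      · rw [indicator_of_notMem hx]
        exact indicator_nonneg (fun _ _ => zero_le_one) x
end

section
/- Let ℱ be a separable family of measurable functions f : 𝒳 → ℝ with measurable envelope F, and let 𝒢(ℱ) = {G_f : f ∈ ℱ} be the family of graphs of functions in ℱ. Suppose dim(𝒢(ℱ)) < ∞. If μ is a probability measure on (𝒳, 𝒮) with ∫ F dμ < ∞, then N_[](ε, ℱ, μ) < ∞ for every ε > 0. -/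
open MeasureTheory Set Filter

/-- A family `ℱ` of real functions is separable if some countable subfamily `ℱ₀ ⊆ ℱ` is
pointwise dense in `ℱ`. -/
def SeparableFamily {X : Type*} (ℱ : Set (X → ℝ)) : Prop :=
  ∃ ℱ₀ ⊆ ℱ, ℱ₀.Countable ∧ ∀ f ∈ ℱ, ∃ g : ℕ → (X → ℝ), (∀ n, g n ∈ ℱ₀) ∧
    ∀ x : X, Filter.Tendsto (fun n => g n x) Filter.atTop (nhds (f x))

/-- The graph of `f : X → ℝ`, a subset of `X × ℝ`. -/
def graphOf {X : Type*} (f : X → ℝ) : Set (X × ℝ) :=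
  {p | (0 ≤ p.2 ∧ p.2 ≤ f p.1) ∨ (f p.1 ≤ p.2 ∧ p.2 ≤ 0)}

open scoped ENNReal Topology

/-- The points at which the functions `g i`, `i ∈ A`, take values on both sides of the
level `s`. -/
def splitSet {X ι : Type*} (g : ι → X → ℝ) (s : ℝ) (A : Set ι) : Set X :=
  {x | (∃ i ∈ A, g i x < s) ∧ ∃ j ∈ A, s < g j x}

lemma splitSet_mono {X ι : Type*} (g : ι → X → ℝ) (s : ℝ) : Monotone (splitSet g s) :=
  fun _ _ hAB _ ⟨⟨i, hi, his⟩, j, hj, hjs⟩ ↦ ⟨⟨i, hAB hi, his⟩, j, hAB hj, hjs⟩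

lemma measurableSet_splitSet {X ι : Type*} [MeasurableSpace X] [Countable ι] {g : ι → X → ℝ}
    (hg : ∀ i, Measurable (g i)) (s : ℝ) (A : Set ι) : MeasurableSet (splitSet g s A) := by
  have h : splitSet g s A = (⋃ i ∈ A, {x | g i x < s}) ∩ ⋃ i ∈ A, {x | s < g i x} := by
    ext x
    simp [splitSet]
  rw [h]
  exact (MeasurableSet.biUnion A.to_countable fun i _ ↦
    measurableSet_lt (hg i) measurable_const).inter
    (MeasurableSet.biUnion A.to_countable fun i _ ↦ measurableSet_lt measurable_const (hg i))

/-- A property of sets satisfied by some member of each ultrafilter holds for all members of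
some finite cover. -/
lemma exists_finite_cover_of_forall_ultrafilter {ι : Type*} {P : Set ι → Prop}
    (h : ∀ U : Ultrafilter ι, ∃ A ∈ U, P A) :
    ∃ T : Set (Set ι), T.Finite ∧ (∀ A ∈ T, P A) ∧ ∀ i, ∃ A ∈ T, i ∈ A := by
  by_contra hcon
  push Not at hcon
  obtain ⟨U, hU⟩ := Ultrafilter.exists_ultrafilter_of_finite_inter_nonempty {A : Set ι | P Aᶜ} (by
    intro T hT
    obtain ⟨i, hi⟩ := hcon (compl '' (T : Set (Set ι))) (T.finite_toSet.image _) (by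
      rintro _ ⟨A, hA, rfl⟩
      exact hT hA)
    refine ⟨i, fun A hA ↦ ?_⟩
    by_contra hiA
    exact hi _ ⟨A, hA, rfl⟩ hiA)
  obtain ⟨A, hA, hPA⟩ := h U
  have : Aᶜ ∈ U := hU (by simpa using hPA)
  exact Ultrafilter.compl_notMem_iff.2 hA this

/-- Countably many monotone set functions are simultaneously minimised over a filter by a
decreasing sequence of its members. -/
lemma exists_antitone_minimizing {ι κ : Type*} [Countable κ] [Nonempty κ] (l : Filter ι)
    (φ : κ → Set ι → ℝ≥0∞) (hφ : ∀ k, Monotone (φ k)) :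
    ∃ B : ℕ → Set ι, Antitone B ∧ (∀ n, B n ∈ l) ∧ ∀ k, ∀ A ∈ l, ⨅ n, φ k (B n) ≤ φ k A := by
  have hex (k : κ) : ∃ C : ℕ → Set ι, (∀ n, C n ∈ l) ∧
      ∀ A ∈ l, ⨅ n, φ k (C n) ≤ φ k A := by
    have hne : (φ k '' {A | A ∈ l}).Nonempty := ⟨_, univ, univ_mem, rfl⟩
    obtain ⟨u, -, hu, hmem⟩ := exists_seq_tendsto_sInf hne (OrderBot.bddBelow _)
    choose C hC hCu using hmem
    refine ⟨C, hC, fun A hA ↦ ?_⟩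
    have h1 : ⨅ n, φ k (C n) ≤ sInf (φ k '' {A | A ∈ l}) := by
      refine ge_of_tendsto' hu fun n ↦ ?_
      rw [← hCu n]
      exact iInf_le _ n
    exact h1.trans (sInf_le ⟨A, hA, rfl⟩)
  choose C hC hCmin using hex
  obtain ⟨e, he⟩ := exists_surjective_nat (κ × ℕ)
  refine ⟨fun n ↦ ⋂ m ∈ Iic n, C (e m).1 (e m).2, fun a b hab ↦ ?_, fun n ↦ ?_, fun k A hA ↦ ?_⟩
  · exact biInter_subset_biInter_left (Iic_subset_Iic.2 hab)
  · exact (biInter_mem (finite_Iic n)).2 fun m _ ↦ hC _ _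
  · refine le_trans (le_iInf fun n ↦ ?_) (hCmin k A hA)
    obtain ⟨m, hm⟩ := he (k, n)
    refine iInf_le_of_le m (hφ k ?_)
    have := biInter_subset_of_mem (s := Iic m) (t := fun m ↦ C (e m).1 (e m).2) (mem_Iic.2 le_rfl)
    simpa only [hm] using this

/-- If the members of an ultrafilter all split almost every point of `D`, then most of the
functions take values both below and above `s` with positive measure on `D`. -/
lemma eventually_split {X ι : Type*} [MeasurableSpace X] [Countable ι] {μ : Measure X}
    {g : ι → X → ℝ} {s : ℝ} {D : Set X} {U : Ultrafilter ι}
    (hD : 0 < μ D) (h : ∀ A ∈ U, μ (D \ splitSet g s A) = 0) :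
    ∀ᶠ i in U, 0 < μ (D ∩ {x | g i x < s}) ∧ 0 < μ (D ∩ {x | s < g i x}) := by
  have key (t : ι → Set X) (ht : ∀ A, splitSet g s A ⊆ ⋃ i ∈ A, t i) :
      ∀ᶠ i in U, 0 < μ (D ∩ t i) := by
    by_contra hcon
    rw [← Ultrafilter.eventually_not] at hcon
    have hA : {i | ¬ 0 < μ (D ∩ t i)} ∈ U := hcon
    set A := {i | ¬ 0 < μ (D ∩ t i)} with hAdef
    have h0 : μ (⋃ i ∈ A, D ∩ t i) = 0 := by
      rw [measure_biUnion_null_iff A.to_countable]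
      intro i hi
      simpa [hAdef] using hi
    refine hD.ne' (measure_mono_null (fun x hx ↦ ?_) (measure_union_null (h A hA) h0))
    by_cases hxs : x ∈ splitSet g s A
    · right
      obtain ⟨i, hi, hix⟩ := mem_iUnion₂.1 (ht A hxs)
      exact mem_iUnion₂.2 ⟨i, hi, hx, hix⟩
    · exact Or.inl ⟨hx, hxs⟩
  refine (key (fun i ↦ {x | g i x < s}) fun A x hx ↦ ?_).and
    (key (fun i ↦ {x | s < g i x}) fun A x hx ↦ ?_)
  · simpa using hx.1
  · simpa using hx.2

/-- All Boolean combinations of level sets of suitably chosen functions meet `E` in positive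
measure. -/
lemma exists_independent {X ι : Type*} [MeasurableSpace X] [Countable ι] {μ : Measure X}
    {g : ι → X → ℝ} {s : ℝ} {E : Set X} {U : Ultrafilter ι}
    (hE : 0 < μ E) (h : ∀ A ∈ U, μ (E \ splitSet g s A) = 0) (n : ℕ) :
    ∃ f : Fin n → ι, ∀ σ : Fin n → Bool,
      0 < μ {x ∈ E | ∀ j, if σ j then s < g (f j) x else g (f j) x < s} := by
  induction n with
  | zero => exact ⟨Fin.elim0, fun σ ↦ by simpa using hE⟩
  | succ n ih =>
    obtain ⟨f, hf⟩ := ih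
    have hev : ∀ᶠ i in (U : Filter ι), ∀ σ : Fin n → Bool, _ :=
      eventually_all.2 fun σ ↦ eventually_split (U := U) (s := s) (g := g) (hf σ) fun A hA ↦
        measure_mono_null (sdiff_subset_sdiff_left (sep_subset _ _)) (h A hA)
    obtain ⟨i, hi⟩ := hev.exists
    refine ⟨Fin.cons i f, fun σ ↦ ?_⟩
    obtain ⟨h1, h2⟩ := hi (Fin.tail σ)
    cases hσ : σ 0
    · refine h1.trans_le (measure_mono fun x hx ↦ ⟨hx.1.1, Fin.cases ?_ fun j ↦ ?_⟩)
      · simpa [hσ] using hx.2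
      · exact hx.1.2 j
    · refine h2.trans_le (measure_mono fun x hx ↦ ⟨hx.1.1, Fin.cases ?_ fun j ↦ ?_⟩)
      · simpa [hσ] using hx.2
      · exact hx.1.2 j

lemma mem_graphOf_of_pos {X : Type*} {f : X → ℝ} {x : X} {s : ℝ} (hs : 0 < s) :
    (x, s) ∈ graphOf f ↔ s ≤ f x := by
  simp [graphOf, hs.le, hs.not_ge]

lemma mem_graphOf_of_neg {X : Type*} {f : X → ℝ} {x : X} {s : ℝ} (hs : s < 0) :
    (x, s) ∈ graphOf f ↔ f x ≤ s := by
  simp [graphOf, hs.le, hs.not_ge]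

/-- If arbitrarily many members of a family are independent at a nonzero level, then its
graphs have infinite VC dimension. -/
lemma not_finiteVC_graphOf {X ι : Type*} {g : ι → X → ℝ} {s : ℝ} (hs : s ≠ 0)
    (h : ∀ n, ∃ f : Fin n → ι, ∀ σ : Fin n → Bool, ∃ x,
      ∀ j, if σ j then s < g (f j) x else g (f j) x < s)
    {ℱ : Set (X → ℝ)} (hg : ∀ i, g i ∈ ℱ) : ¬ FiniteVC (graphOf '' ℱ) := by
  classical
  rintro ⟨k, hk⟩
  let e := Fintype.equivFin (Set (Fin (k + 1)))
  obtain ⟨f, hf⟩ := h (Fintype.card (Set (Fin (k + 1))))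
  choose p hp using hf
  let y (j : Fin (k + 1)) : X := p fun m ↦ decide (j ∈ e.symm m)
  have hmem (j) (S : Set (Fin (k + 1))) (hj : j ∈ S) : s < g (f (e S)) (y j) := by
    simpa [hj] using hp (fun m ↦ decide (j ∈ e.symm m)) (e S)
  have hnot (j) (S : Set (Fin (k + 1))) (hj : j ∉ S) : g (f (e S)) (y j) < s := by
    simpa [hj] using hp (fun m ↦ decide (j ∈ e.symm m)) (e S)
  have hinj : Function.Injective fun j ↦ (y j, s) := by
    intro a b hab
    by_contra hne
    have h1 := hmem a {a} rfl
    have h2 := hnot b {a} (by simpa using Ne.symm hne)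
    rw [show y a = y b from congrArg Prod.fst hab] at h1
    exact lt_asymm h1 h2
  have hcard := hk (Finset.univ.image fun j ↦ (y j, s)) (by
    intro B _
    rcases hs.lt_or_gt with hs | hs
    · refine ⟨_, ⟨_, hg (f (e {j | (y j, s) ∉ B})), rfl⟩, ?_⟩
      simp only [Finset.mem_image, Finset.mem_univ, true_and, forall_exists_index,
        forall_apply_eq_imp_iff, mem_graphOf_of_neg hs]
      intro j
      by_cases hj : (y j, s) ∈ B
      · simpa [hj] using (hnot j {j | (y j, s) ∉ B} (by simpa using hj)).le
      · simpa [hj] using hmem j {j | (y j, s) ∉ B} hj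
    · refine ⟨_, ⟨_, hg (f (e {j | (y j, s) ∈ B})), rfl⟩, ?_⟩
      simp only [Finset.mem_image, Finset.mem_univ, true_and, forall_exists_index,
        forall_apply_eq_imp_iff, mem_graphOf_of_pos hs]
      intro j
      by_cases hj : (y j, s) ∈ B
      · simpa [hj] using (hmem j {j | (y j, s) ∈ B} hj).le
      · simpa [hj] using hnot j {j | (y j, s) ∈ B} hj)
  rw [Finset.card_image_of_injective _ hinj] at hcard
  simp at hcard

lemma exists_ne_zero_rat_btwn {a b : ℝ} (hab : a < b) : ∃ q : ℚ, q ≠ 0 ∧ a < q ∧ q < b := by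
  obtain ⟨q, h1, h2⟩ := exists_rat_btwn hab
  rcases eq_or_ne q 0 with rfl | hq
  · obtain ⟨r, h3, h4⟩ := exists_rat_btwn h2
    exact ⟨r, by rintro rfl; exact h3.false, h1.trans h3, h4⟩
  · exact ⟨q, hq, h1, h2⟩

/-- If no nonzero rational level is split by all sets of a decreasing sequence, the
oscillations over these sets tend to zero. -/
lemma tendsto_oscillation {X ι : Type*} {g : ι → X → ℝ} {M : ℝ} {x : X}
    (hM : ∀ i, |g i x| ≤ M) {B : ℕ → Set ι} (hB : Antitone B) (hne : ∀ n, (B n).Nonempty)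
    (h : ∀ q : ℚ, q ≠ 0 → ∃ n, x ∉ splitSet g q (B n)) :
    Tendsto (fun n ↦ (⨆ i : B n, g i x) - ⨅ i : B n, g i x) atTop (𝓝 0) := by
  have hne' (n) : Nonempty (B n) := (hne n).to_subtype
  have hbA (n) : BddAbove (range fun i : B n ↦ g i x) :=
    ⟨M, by rintro _ ⟨i, rfl⟩; exact (abs_le.1 (hM i)).2⟩
  have hbB (n) : BddBelow (range fun i : B n ↦ g i x) :=
    ⟨-M, by rintro _ ⟨i, rfl⟩; exact (abs_le.1 (hM i)).1⟩
  have hle (n) : (⨅ i : B n, g i x) ≤ ⨆ i : B n, g i x := ciInf_le_ciSup (hbB n) (hbA n)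
  have hu : Antitone fun n ↦ ⨆ i : B n, g i x := fun m n hmn ↦
    ciSup_le fun i ↦ le_ciSup (hbA m) ⟨i, hB hmn i.2⟩
  have hl : Monotone fun n ↦ ⨅ i : B n, g i x := fun m n hmn ↦
    le_ciInf fun i ↦ ciInf_le (hbB m) ⟨i, hB hmn i.2⟩
  have hbu : BddBelow (range fun n ↦ ⨆ i : B n, g i x) :=
    ⟨⨅ i : B 0, g i x, by rintro _ ⟨n, rfl⟩; exact (hl (Nat.zero_le n)).trans (hle n)⟩
  have hbl : BddAbove (range fun n ↦ ⨅ i : B n, g i x) :=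
    ⟨⨆ i : B 0, g i x, by rintro _ ⟨n, rfl⟩; exact (hle n).trans (hu (Nat.zero_le n))⟩
  have hlim := (tendsto_atTop_ciInf hu hbu).sub (tendsto_atTop_ciSup hl hbl)
  have heq : (⨅ n, ⨆ i : B n, g i x) = ⨆ n, ⨅ i : B n, g i x := by
    apply le_antisymm
    · by_contra hlt
      obtain ⟨q, hq, h1, h2⟩ := exists_ne_zero_rat_btwn (not_le.1 hlt)
      obtain ⟨n, hn⟩ := h q hq
      obtain ⟨i, hi⟩ := exists_lt_of_ciInf_lt ((le_ciSup hbl n).trans_lt h1)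
      obtain ⟨j, hj⟩ := exists_lt_of_lt_ciSup (h2.trans_le (ciInf_le hbu n))
      exact hn ⟨⟨i, i.2, hi⟩, j, j.2, hj⟩
    · exact le_of_tendsto_of_tendsto' (tendsto_atTop_ciSup hl hbl) (tendsto_atTop_ciInf hu hbu) hle
  rwa [heq, sub_self] at hlim

/-- Every ultrafilter on a countable family with an integrable envelope and graphs of finite
VC dimension has members of arbitrarily small mean oscillation. -/
lemma exists_mem_ultrafilter_oscillation_le {X ι : Type*} [MeasurableSpace X] [Countable ι]
    {μ : Measure X} [IsFiniteMeasure μ] {g : ι → X → ℝ} (hg : ∀ i, Measurable (g i))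
    {F : X → ℝ} (hFint : Integrable F μ) (henv : ∀ i x, |g i x| ≤ F x)
    {ℱ : Set (X → ℝ)} (hgℱ : ∀ i, g i ∈ ℱ) (hgraph : FiniteVC (graphOf '' ℱ))
    {ε : ℝ} (hε : 0 < ε) (U : Ultrafilter ι) :
    ∃ A ∈ U, A.Nonempty ∧
      ∫⁻ x, ENNReal.ofReal ((⨆ i : A, g i x) - ⨅ i : A, g i x) ∂μ ≤ ENNReal.ofReal ε := by
  have hms (q : ℚ) (A) := measurableSet_splitSet hg q A
  obtain ⟨B, hB, hBU, hmin⟩ := exists_antitone_minimizing (U : Filter ι)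
    (fun (q : ℚ) A ↦ μ (splitSet g q A)) fun q _ _ hA ↦ measure_mono (splitSet_mono g q hA)
  have hBne (n) : (B n).Nonempty := U.nonempty_of_mem (hBU n)
  have hnull (q : ℚ) (A) (hA : A ∈ U) :
      μ ((⋂ n, splitSet g q (B n)) \ splitSet g q A) = 0 := by
    set E := ⋂ n, splitSet g q (B n) with hE
    have hEle : μ E ≤ μ (E ∩ splitSet g q A) := by
      have hlim := tendsto_measure_iInter_atTop (μ := μ)
        (s := fun n ↦ splitSet g q (B n) ∩ splitSet g q A)
        (fun n ↦ ((hms q _).inter (hms q A)).nullMeasurableSet)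
        (fun m n hmn ↦ inter_subset_inter_left _ (splitSet_mono g q (hB hmn)))
        ⟨0, measure_ne_top _ _⟩
      rw [← iInter_inter] at hlim
      refine ge_of_tendsto' hlim fun n ↦ ?_
      calc μ E ≤ ⨅ m, μ (splitSet g q (B m)) :=
            le_iInf fun m ↦ measure_mono (iInter_subset _ m)
        _ ≤ μ (splitSet g q (B n ∩ A)) := hmin q _ (inter_mem (hBU n) hA)
        _ ≤ _ := measure_mono (subset_inter (splitSet_mono g q inter_subset_left)
            (splitSet_mono g q inter_subset_right))
    rw [← sdiff_inter_self_eq_sdiff, inter_comm, measure_sdiff inter_subset_left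
      ((MeasurableSet.iInter fun n ↦ hms q _).inter (hms q A)).nullMeasurableSet
      (measure_ne_top _ _)]
    exact tsub_eq_zero_of_le hEle
  have hzero (q : ℚ) (hq : q ≠ 0) : μ (⋂ n, splitSet g q (B n)) = 0 := by
    by_contra hpos
    refine not_finiteVC_graphOf (g := g) (s := q) (by exact_mod_cast hq) (fun n ↦ ?_) hgℱ hgraph
    obtain ⟨f, hf⟩ := exists_independent (pos_iff_ne_zero.2 hpos) (hnull q) n
    refine ⟨f, fun σ ↦ ?_⟩
    obtain ⟨x, hx⟩ := nonempty_of_measure_ne_zero (hf σ).ne'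
    exact ⟨x, hx.2⟩
  have hae : ∀ᵐ x ∂μ, ∀ q : ℚ, q ≠ 0 → ∃ n, x ∉ splitSet g q (B n) := by
    refine ae_all_iff.2 fun q ↦ ?_
    rcases eq_or_ne q 0 with rfl | hq
    · simp
    · filter_upwards [measure_eq_zero_iff_ae_notMem.1 (hzero q hq)] with x hx _
      simpa using hx
  have hlim : Tendsto (fun n ↦ ∫⁻ x, ENNReal.ofReal
      ((⨆ i : B n, g i x) - ⨅ i : B n, g i x) ∂μ) atTop (𝓝 (∫⁻ _, 0 ∂μ)) := by
    refine tendsto_lintegral_of_dominated_convergence (fun x ↦ ENNReal.ofReal (F x + F x))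
      (fun n ↦ ?_) (fun n ↦ .of_forall fun x ↦ ?_) ?_ ?_
    · exact ((Measurable.iSup fun i : B n ↦ hg i).sub
        (Measurable.iInf fun i : B n ↦ hg i)).ennreal_ofReal
    · have := (hBne n).to_subtype
      refine ENNReal.ofReal_le_ofReal ?_
      have h1 : (⨆ i : B n, g i x) ≤ F x := ciSup_le fun i ↦ (abs_le.1 (henv i x)).2
      have h2 : -F x ≤ ⨅ i : B n, g i x := le_ciInf fun i ↦ (abs_le.1 (henv i x)).1
      linarith
    · exact (hFint.add hFint).lintegral_lt_top.ne
    · filter_upwards [hae] with x hx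
      simpa using ENNReal.tendsto_ofReal (tendsto_oscillation (henv · x) hB hBne hx)
  rw [lintegral_zero] at hlim
  obtain ⟨n, hn⟩ := (hlim.eventually (gt_mem_nhds (ENNReal.ofReal_pos.2 hε))).exists
  exact ⟨B n, hBU n, hBne n, hn.le⟩

/-- **Proposition 2 (VC graph families).** If the family of graphs `𝒢(ℱ)` has finite VC
dimension and the envelope `F` of the separable family `ℱ` is `μ`-integrable, then `ℱ` has
finite bracketing numbers w.r.t. `μ`. -/
theorem vc_graph_finite_bracketing {X : Type*} [MeasurableSpace X]
    (ℱ : Set (X → ℝ)) (hmeas : ∀ f ∈ ℱ, Measurable f) (hsep : SeparableFamily ℱ)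
    (F : X → ℝ) (hF : Measurable F) (hF0 : ∀ x, 0 ≤ F x)
    (henv : ∀ f ∈ ℱ, ∀ x, |f x| ≤ F x)
    (hgraph : FiniteVC (graphOf '' ℱ))
    (μ : Measure X) [IsProbabilityMeasure μ] (hFint : Integrable F μ) :
    FiniteBracketing μ ℱ := by
  intro ε hε
  obtain ⟨ℱ₀, hsub, hcount, hdense⟩ := hsep
  have : Countable ℱ₀ := hcount.to_subtype
  let g (i : ℱ₀) : X → ℝ := i
  have hg (i) : Measurable (g i) := hmeas _ (hsub i.2)
  have hgF (i x) : |g i x| ≤ F x := henv _ (hsub i.2) x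
  obtain ⟨T, hTfin, hT, hcover⟩ := exists_finite_cover_of_forall_ultrafilter
    (exists_mem_ultrafilter_oscillation_le hg hFint hgF (fun i ↦ hsub i.2) hgraph hε)
  have := hTfin.to_subtype
  obtain ⟨n, ⟨e⟩⟩ := Finite.exists_equiv_fin T
  have hbA (A : Set ℱ₀) (x : X) : BddAbove (range fun i : A ↦ g i x) :=
    ⟨F x, by rintro _ ⟨i, rfl⟩; exact (abs_le.1 (hgF i x)).2⟩
  have hbB (A : Set ℱ₀) (x : X) : BddBelow (range fun i : A ↦ g i x) :=
    ⟨-F x, by rintro _ ⟨i, rfl⟩; exact (abs_le.1 (hgF i x)).1⟩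
  refine ⟨n, fun k x ↦ ⨅ i : (e.symm k).1, g i x, fun k x ↦ ⨆ i : (e.symm k).1, g i x,
    fun k ↦ ⟨Measurable.iInf fun i ↦ hg i, Measurable.iSup fun i ↦ hg i, fun x ↦ ?_,
      (hT _ (e.symm k).2).2⟩, fun f hf ↦ ?_⟩
  · have := (hT _ (e.symm k).2).1.to_subtype
    exact ciInf_le_ciSup (hbB _ x) (hbA _ x)
  · obtain ⟨u, hu, hlim⟩ := hdense f hf
    choose A hAT hA using fun m ↦ hcover ⟨u m, hu m⟩
    obtain ⟨t, ht⟩ := Finite.exists_infinite_fiber fun m ↦ (⟨A m, hAT m⟩ : T)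
    have hfreq : ∃ᶠ m in atTop, (⟨A m, hAT m⟩ : T) = t :=
      Nat.frequently_atTop_iff_infinite.2 (Set.infinite_coe_iff.1 ht)
    obtain ⟨k, rfl⟩ := e.symm.surjective t
    have hmem (m) (hm : (⟨A m, hAT m⟩ : T) = e.symm k) : ⟨u m, hu m⟩ ∈ (e.symm k).1 := by
      rw [← hm]
      exact hA m
    exact ⟨k, fun x ↦
      ⟨ge_of_tendsto_of_frequently (hlim x) (hfreq.mono fun m hm ↦
        ciInf_le (hbB _ x) ⟨_, hmem m hm⟩),
      le_of_tendsto_of_frequently (hlim x) (hfreq.mono fun m hm ↦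
        le_ciSup (hbA _ x) ⟨_, hmem m hm⟩)⟩⟩
end

section
/- If 𝒞 is a separable family of measurable sets with finite VC dimension and X = X₁, X₂, … is a stationary ergodic process with values in (𝒳, 𝒮) and marginal distribution μ, then the discrepancy Δₙ(𝒞 : X) = sup_{C ∈ 𝒞} | n⁻¹ Σ_{i=1}^n 1_C(X_i) − μ(C) | converges to 0 almost surely as n → ∞. -/
open MeasureTheory Set Filter

section Birkhoff

variable {Ω : Type*}

/-- The running maximum of the Birkhoff sums `birkhoffSum T f k`, `1 ≤ k ≤ n + 1`, in its
recursive form. -/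
noncomputable def birkhoffMax (T : Ω → Ω) (f : Ω → ℝ) : ℕ → Ω → ℝ
  | 0, x => f x
  | n + 1, x => f x + max 0 (birkhoffMax T f n (T x))

theorem birkhoffSum_le_birkhoffMax (T : Ω → Ω) (f : Ω → ℝ) (n : ℕ) (x : Ω) :
    birkhoffSum T f (n + 1) x ≤ birkhoffMax T f n x := by
  induction n generalizing x with
  | zero => simp [birkhoffMax]
  | succ n ih =>
    rw [birkhoffSum_succ', birkhoffMax]
    exact add_le_add le_rfl ((ih _).trans (le_max_right _ _))

theorem birkhoffMax_le_succ (T : Ω → Ω) (f : Ω → ℝ) (n : ℕ) (x : Ω) :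
    birkhoffMax T f n x ≤ birkhoffMax T f (n + 1) x := by
  induction n generalizing x with
  | zero => simp [birkhoffMax]
  | succ n ih =>
    rw [birkhoffMax, birkhoffMax]
    exact add_le_add le_rfl (max_le_max le_rfl (ih _))

theorem monotone_birkhoffMax (T : Ω → Ω) (f : Ω → ℝ) (x : Ω) :
    Monotone fun n => birkhoffMax T f n x :=
  monotone_nat_of_le_succ fun n => birkhoffMax_le_succ T f n x

theorem bddAbove_range_birkhoffMax_comp (T : Ω → Ω) (f : Ω → ℝ) (x : Ω) :
    BddAbove (range fun n => birkhoffMax T f n (T x)) ↔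
      BddAbove (range fun n => birkhoffMax T f n x) := by
  constructor
  · rintro ⟨K, hK⟩
    refine ⟨f x + max 0 K, ?_⟩
    rintro _ ⟨n, rfl⟩
    refine (birkhoffMax_le_succ T f n x).trans ?_
    exact add_le_add le_rfl (max_le_max le_rfl (hK ⟨n, rfl⟩))
  · rintro ⟨K, hK⟩
    refine ⟨K - f x, ?_⟩
    rintro _ ⟨n, rfl⟩
    have h : f x + max 0 (birkhoffMax T f n (T x)) ≤ K := hK ⟨n + 1, rfl⟩
    have := le_max_right 0 (birkhoffMax T f n (T x))
    simp only
    linarith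

variable [MeasurableSpace Ω] {P : Measure Ω} {T : Ω → Ω} {f : Ω → ℝ}

theorem measurable_birkhoffMax (hT : Measurable T) (hf : Measurable f) (n : ℕ) :
    Measurable (birkhoffMax T f n) := by
  induction n with
  | zero => exact hf
  | succ n ih => exact hf.add (measurable_const.max (ih.comp hT))

theorem integrable_birkhoffMax (hT : MeasurePreserving T P P) (hf : Integrable f P) (n : ℕ) :
    Integrable (birkhoffMax T f n) P := by
  induction n with
  | zero => exact hf
  | succ n ih =>
    exact hf.add ((integrable_zero Ω ℝ P).sup (hT.integrable_comp_of_integrable ih))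

/-- If the running maxima of the Birkhoff sums of `f` are almost surely unbounded, then
`f` has nonnegative integral. -/
theorem integral_nonneg_of_not_bddAbove_birkhoffMax (hT : MeasurePreserving T P P)
    (hfi : Integrable f P)
    (h : ∀ᵐ x ∂P, ¬ BddAbove (range fun n => birkhoffMax T f n x)) : 0 ≤ ∫ x, f x ∂P := by
  have hcomp : Integrable (fun x => f (T x)) P := hT.integrable_comp_of_integrable hfi
  have hint (n : ℕ) : Integrable (fun x => birkhoffMax T f n (T x)) P :=
    hT.integrable_comp_of_integrable (integrable_birkhoffMax hT hfi n)
  have hlim : Tendsto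
      (fun n => ∫ x, (birkhoffMax T f (n + 1) x - birkhoffMax T f n (T x)) ∂P) atTop
      (nhds (∫ x, f x ∂P)) := by
    refine tendsto_integral_of_dominated_convergence (fun x => |f x| + |f (T x)|) ?_
      (hfi.abs.add hcomp.abs) ?_ ?_
    · exact fun n => ((integrable_birkhoffMax hT hfi _).sub (hint n)).aestronglyMeasurable
    · refine fun n => .of_forall fun x => ?_
      have h0 : f (T x) ≤ birkhoffMax T f n (T x) := monotone_birkhoffMax T f (T x) n.zero_le
      rw [birkhoffMax, Real.norm_eq_abs]
      rcases le_total 0 (birkhoffMax T f n (T x)) with h1 | h1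
      · rw [max_eq_right h1, add_sub_cancel_right]
        exact le_add_of_nonneg_right (abs_nonneg _)
      · rw [max_eq_left h1, add_zero]
        refine (abs_sub _ _).trans (add_le_add le_rfl ?_)
        rw [abs_of_nonpos h1, abs_of_nonpos (h0.trans h1)]
        exact neg_le_neg h0
    · filter_upwards [h] with x hx
      rw [← bddAbove_range_birkhoffMax_comp] at hx
      refine tendsto_const_nhds.congr' ?_
      have := tendsto_atTop_atTop_of_monotone' (monotone_birkhoffMax T f (T x)) hx
      filter_upwards [this.eventually_ge_atTop 0] with n hn
      rw [birkhoffMax, max_eq_right hn, add_sub_cancel_right]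
  refine ge_of_tendsto' hlim fun n => ?_
  have hmap : ∫ x, birkhoffMax T f n (T x) ∂P = ∫ x, birkhoffMax T f n x ∂P := by
    conv_rhs => rw [← hT.map_eq]
    refine (integral_map hT.aemeasurable ?_).symm
    rw [hT.map_eq]
    exact (integrable_birkhoffMax hT hfi n).aestronglyMeasurable
  rw [integral_sub (integrable_birkhoffMax hT hfi _) (hint n), hmap, sub_nonneg]
  exact integral_mono (integrable_birkhoffMax hT hfi n) (integrable_birkhoffMax hT hfi _)
    fun x => birkhoffMax_le_succ T f n x

theorem Ergodic.ae_bddAbove_birkhoffSum (hT : Ergodic T P) (hf : Measurable f)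
    (hfi : Integrable f P) (hneg : ∫ x, f x ∂P < 0) :
    ∀ᵐ x ∂P, ∃ K, ∀ n, birkhoffSum T f n x ≤ K := by
  have hinv : T ⁻¹' {x | BddAbove (range fun n => birkhoffMax T f n x)} =
      {x | BddAbove (range fun n => birkhoffMax T f n x)} :=
    ext fun x => bddAbove_range_birkhoffMax_comp T f x
  rcases hT.ae_mem_or_ae_notMem
    (measurableSet_bddAbove_range (measurable_birkhoffMax hT.measurable hf)) hinv with h | h
  · filter_upwards [h] with x ⟨K, hK⟩
    refine ⟨max 0 K, fun n => ?_⟩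
    cases n with
    | zero => simp
    | succ n =>
      exact (birkhoffSum_le_birkhoffMax T f n x).trans ((hK ⟨n, rfl⟩).trans (le_max_right _ _))
  · exact absurd (integral_nonneg_of_not_bddAbove_birkhoffMax hT.toMeasurePreserving hfi h)
      hneg.not_ge

theorem Ergodic.ae_eventually_birkhoffAverage_le [IsProbabilityMeasure P] (hT : Ergodic T P)
    (hf : Measurable f) (hfi : Integrable f P) {ε : ℝ} (hε : 0 < ε) :
    ∀ᵐ x ∂P, ∀ᶠ n in atTop, birkhoffAverage ℝ T f n x ≤ ∫ x, f x ∂P + ε := by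
  set c := ∫ x, f x ∂P + ε / 2 with hc
  have hneg : ∫ x, (f x - c) ∂P < 0 := by
    rw [integral_sub hfi (integrable_const c)]
    simp only [integral_const, probReal_univ, one_smul]
    linarith
  filter_upwards [hT.ae_bddAbove_birkhoffSum (hf.sub_const c)
    (hfi.sub (integrable_const c)) hneg] with x ⟨K, hK⟩
  have hlim := tendsto_const_div_atTop_nhds_zero_nat K
  filter_upwards [hlim.eventually_le_const (half_pos hε), eventually_gt_atTop 0] with n hn hn0
  have hn0' : (0 : ℝ) < n := by exact_mod_cast hn0
  have hsum : birkhoffSum T f n x ≤ K + n * c := by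
    have := hK n
    simp only [birkhoffSum, Finset.sum_sub_distrib, Finset.sum_const, Finset.card_range,
      nsmul_eq_mul] at this
    simp only [birkhoffSum]
    linarith
  calc birkhoffAverage ℝ T f n x = (n : ℝ)⁻¹ * birkhoffSum T f n x := rfl
    _ ≤ (n : ℝ)⁻¹ * (K + n * c) := by gcongr
    _ = K / n + c := by field_simp
    _ ≤ _ := by linarith

/-- Birkhoff's pointwise ergodic theorem for an ergodic transformation of a probability
space. -/
theorem Ergodic.ae_tendsto_birkhoffAverage [IsProbabilityMeasure P] (hT : Ergodic T P)
    (hf : Measurable f) (hfi : Integrable f P) :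
    ∀ᵐ x ∂P, Tendsto (fun n => birkhoffAverage ℝ T f n x) atTop (nhds (∫ x, f x ∂P)) := by
  have hpos (k : ℕ) : (0 : ℝ) < 1 / ((k : ℝ) + 1) := Nat.one_div_pos_of_nat
  have hu := ae_all_iff.2 fun k : ℕ => hT.ae_eventually_birkhoffAverage_le hf hfi (hpos k)
  have hl := ae_all_iff.2 fun k : ℕ =>
    hT.ae_eventually_birkhoffAverage_le hf.neg hfi.neg (hpos k)
  filter_upwards [hu, hl] with x hux hlx
  refine Metric.tendsto_atTop'.2 fun ε hε => ?_
  obtain ⟨k, hk⟩ := exists_nat_one_div_lt hε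
  obtain ⟨N, hN⟩ := eventually_atTop.1 ((hux k).and (hlx k))
  refine ⟨N, fun n hn => ?_⟩
  obtain ⟨h1, h2⟩ := hN n hn.le
  have h3 : birkhoffAverage ℝ T (-f) n x = -birkhoffAverage ℝ T f n x := by
    simp [birkhoffAverage, birkhoffSum]
  have h4 : ∫ x, (-f) x ∂P = -∫ x, f x ∂P := integral_neg f
  rw [h3, h4] at h2
  rw [Real.dist_eq, abs_lt]
  constructor <;> linarith

end Birkhoff

section Bracketing

variable {X : Type*} [MeasurableSpace X] {μ : Measure X}

/-- A class of sets closed under finite unions has a countable increasing exhaustion, up to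
null sets. -/
theorem exists_monotone_seq_measure_diff_iUnion_eq_zero (μ : Measure X) [IsFiniteMeasure μ]
    {p : Set X → Prop} (hmeas : ∀ A, p A → MeasurableSet A) (hempty : p ∅)
    (hunion : ∀ A B, p A → p B → p (A ∪ B)) :
    ∃ G : ℕ → Set X, (∀ n, p (G n)) ∧ Monotone G ∧ ∀ A, p A → μ (A \ ⋃ n, G n) = 0 := by
  obtain ⟨u, -, hu, hup⟩ := exists_seq_tendsto_sSup (S := μ '' {A | p A})
    ⟨_, mem_image_of_mem μ hempty⟩ (OrderTop.bddAbove _)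
  choose F hF hFu using hup
  have hG (n : ℕ) : p (partialSups F n) := by
    induction n with
    | zero => simpa using hF 0
    | succ n ih => rw [partialSups_add_one]; exact hunion _ _ ih (hF _)
  refine ⟨partialSups F, hG, (partialSups F).monotone, fun A hA => ?_⟩
  have hs : sSup (μ '' {A | p A}) ≤ μ (⋃ n, partialSups F n) :=
    le_of_tendsto' hu fun n => by
      rw [← hFu n]
      exact measure_mono ((le_partialSups F n).trans (subset_iUnion (partialSups F) n))
  have hA' : μ (A ∪ ⋃ n, partialSups F n) ≤ μ (⋃ n, partialSups F n) := by
    have hm : Monotone fun n => A ∪ partialSups F n := fun i j hij =>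
      union_subset_union_right A ((partialSups F).monotone hij)
    rw [union_iUnion, hm.measure_iUnion]
    exact (iSup_le fun n => le_sSup (mem_image_of_mem μ (hunion _ _ hA (hG n)))).trans hs
  have hGm : MeasurableSet (⋃ n, partialSups F n) := .iUnion fun n => hmeas _ (hG n)
  rw [← union_sdiff_right, measure_sdiff subset_union_right hGm.nullMeasurableSet
    (measure_ne_top _ _), tsub_eq_zero_of_le hA']

/-- The points of `B` whose membership in the sets `C i` is prescribed by `t`. -/
def joinCell {X ι : Type*} (B : Set X) (C : ι → Set X) (s : Finset ι) (t : Set ι) : Set X :=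
  {x ∈ B | ∀ i ∈ s, x ∈ C i ↔ i ∈ t}

theorem joinCell_insert {X ι : Type*} [DecidableEq ι] (B : Set X) (C : ι → Set X) (s : Finset ι)
    (t : Set ι) {a : ι} (ha : a ∉ s) (D : Set X) :
    joinCell B (Function.update C a D) (insert a s) t =
      joinCell B C s t ∩ {x | x ∈ D ↔ a ∈ t} := by
  ext x
  have (i : ι) (hi : i ∈ s) : Function.update C a D i = C i :=
    Function.update_of_ne (ne_of_mem_of_not_mem hi ha) D C
  simp +contextual only [joinCell, mem_ofPred_eq, Finset.mem_insert, forall_eq_or_imp,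
    Function.update_self, mem_inter_iff, this]
  tauto

/-- If every non-null measurable part of `B` is split by `𝒰`-almost every set, then
arbitrarily large finite collections of sets of the class cut `B` into all the possible cells. -/
theorem exists_forall_measure_joinCell_pos {𝒰 : Ultrafilter (Set X)} {𝒞 : Set (Set X)}
    (h𝒰 : 𝒞 ∈ 𝒰) (h𝒞 : ∀ C ∈ 𝒞, MeasurableSet C) {B : Set X} (hB : MeasurableSet B)
    (hBpos : 0 < μ B)
    (hsplit : ∀ A ⊆ B, MeasurableSet A → 0 < μ A →
      ∀ᶠ C in 𝒰, 0 < μ (A ∩ C) ∧ 0 < μ (A \ C))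
    {ι : Type*} [Finite ι] (s : Finset ι) :
    ∃ C : ι → Set X, (∀ i ∈ s, C i ∈ 𝒞) ∧
      ∀ t : Set ι, MeasurableSet (joinCell B C s t) ∧ 0 < μ (joinCell B C s t) := by
  classical
  induction s using Finset.induction_on with
  | empty => exact ⟨fun _ => ∅, by simp, fun t => by simpa [joinCell] using ⟨hB, hBpos⟩⟩
  | insert a s ha ih =>
    obtain ⟨C, hC, hcell⟩ := ih
    have hev : ∀ᶠ D in (𝒰 : Filter (Set X)), ∀ t : Set ι,
        0 < μ (joinCell B C s t ∩ D) ∧ 0 < μ (joinCell B C s t \ D) :=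
      eventually_all.2 fun t => hsplit _ (sep_subset _ _) (hcell t).1 (hcell t).2
    obtain ⟨D, hD, hD𝒞⟩ := (hev.and (eventually_mem_set.2 h𝒰)).exists
    refine ⟨Function.update C a D, fun i hi => ?_, fun t => ?_⟩
    · rcases Finset.mem_insert.1 hi with rfl | his
      · rw [Function.update_self]
        exact hD𝒞
      · rw [Function.update_of_ne (ne_of_mem_of_not_mem his ha)]
        exact hC i his
    · rw [joinCell_insert B C s t ha D]
      by_cases hat : a ∈ t
      · simp only [hat, iff_true, ofPred_mem_eq]
        exact ⟨(hcell t).1.inter (h𝒞 D hD𝒞), (hD t).1⟩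
      · simp only [hat, iff_false]
        exact ⟨(hcell t).1.diff (h𝒞 D hD𝒞), (hD t).2⟩

/-- A class of finite VC dimension has finite dual VC dimension. -/
theorem FiniteVC.exists_join_cell_empty {X : Type*} {𝒞 : Set (Set X)} (hVC : FiniteVC 𝒞) :
    ∃ k : ℕ, ∀ C : Set (Fin k) → Set X, (∀ i, C i ∈ 𝒞) →
      ∃ t : Set (Set (Fin k)), ∀ x, ¬ ∀ i, x ∈ C i ↔ i ∈ t := by
  classical
  obtain ⟨k, hk⟩ := hVC
  refine ⟨k + 1, fun C hC => ?_⟩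
  by_contra! h
  choose x hx using fun j : Fin (k + 1) => h {S | j ∈ S}
  have hinj : Function.Injective x := fun j l hjl => by
    have h1 : x l ∈ C {j} := hjl ▸ (hx j {j}).2 (mem_singleton j)
    exact ((hx l {j}).1 h1).symm
  have hshat : Shatters 𝒞 (Finset.univ.image x) := fun B _ =>
    ⟨C {j | x j ∈ B}, hC _, fun y hy => by
      obtain ⟨j, -, rfl⟩ := Finset.mem_image.1 hy
      exact hx j _⟩
  have := hk _ hshat
  rw [Finset.card_image_of_injective _ hinj, Finset.card_univ, Fintype.card_fin] at this
  omega

/-- Every ultrafilter on a class of measurable sets of finite VC dimension contains a subclass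
covered by a single bracket of small measure. -/
theorem FiniteVC.exists_bracket_of_ultrafilter [IsFiniteMeasure μ] {𝒞 : Set (Set X)}
    (hVC : FiniteVC 𝒞) (h𝒞 : ∀ C ∈ 𝒞, MeasurableSet C) {𝒰 : Ultrafilter (Set X)}
    (h𝒰 : 𝒞 ∈ 𝒰) {ε : ENNReal} (hε : 0 < ε) :
    ∃ L H : Set X, MeasurableSet L ∧ MeasurableSet H ∧ μ (H \ L) ≤ ε ∧
      ∀ᶠ C in 𝒰, μ (L \ C) = 0 ∧ μ (C \ H) = 0 := by
  obtain ⟨G, hG, hGmono, hGmax⟩ := exists_monotone_seq_measure_diff_iUnion_eq_zero μ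
    (p := fun A => MeasurableSet A ∧ ∀ᶠ C in 𝒰, μ (A \ C) = 0) (fun A hA => hA.1)
    (by simp) (fun A B hA hB => ⟨hA.1.union hB.1, by
      filter_upwards [hA.2, hB.2] with C h1 h2
      rw [union_sdiff_distrib]
      exact measure_union_null h1 h2⟩)
  obtain ⟨F, hF, hFmono, hFmax⟩ := exists_monotone_seq_measure_diff_iUnion_eq_zero μ
    (p := fun A => MeasurableSet A ∧ ∀ᶠ C in 𝒰, μ (A ∩ C) = 0) (fun A hA => hA.1)
    (by simp) (fun A B hA hB => ⟨hA.1.union hB.1, by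
      filter_upwards [hA.2, hB.2] with C h1 h2
      rw [union_inter_distrib_right]
      exact measure_union_null h1 h2⟩)
  set B : ℕ → Set X := fun n => (F n)ᶜ \ G n
  have hBm (n : ℕ) : MeasurableSet (B n) := (hF n).1.compl.diff (hG n).1
  have hBanti : Antitone B := fun i j hij =>
    sdiff_subset_sdiff (compl_subset_compl.2 (hFmono hij)) (hGmono hij)
  have hnull : μ (⋂ n, B n) = 0 := by
    by_contra hpos
    obtain ⟨k, hk⟩ := hVC.exists_join_cell_empty
    obtain ⟨C, hC, hcell⟩ := exists_forall_measure_joinCell_pos (μ := μ) h𝒰 h𝒞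
      (MeasurableSet.iInter hBm) (pos_iff_ne_zero.2 hpos) (fun A hAB hA hApos => by
        simp only [pos_iff_ne_zero, eventually_and]
        constructor <;> refine Ultrafilter.eventually_not.2 fun h => ?_
        · have hdisj : A \ ⋃ n, F n = A := by
            rw [sdiff_eq_left, disjoint_iUnion_right]
            exact fun n => disjoint_left.2 fun x hx hxF => (mem_iInter.1 (hAB hx) n).1 hxF
          exact hApos.ne' (hdisj ▸ hFmax A ⟨hA, h⟩)
        · have hdisj : A \ ⋃ n, G n = A := by
            rw [sdiff_eq_left, disjoint_iUnion_right]
            exact fun n => disjoint_left.2 fun x hx hxG => (mem_iInter.1 (hAB hx) n).2 hxG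
          exact hApos.ne' (hdisj ▸ hGmax A ⟨hA, h⟩))
      (Finset.univ : Finset (Set (Fin k)))
    obtain ⟨t, ht⟩ := hk C fun i => hC i (Finset.mem_univ i)
    obtain ⟨x, hx⟩ := nonempty_of_measure_ne_zero (hcell t).2.ne'
    exact ht x fun i => hx.2 i (Finset.mem_univ i)
  have hlim := tendsto_measure_iInter_atTop (fun n => (hBm n).nullMeasurableSet) hBanti
    ⟨0, measure_ne_top μ _⟩
  rw [hnull] at hlim
  obtain ⟨n, hn⟩ := (hlim.eventually_le_const hε).exists
  refine ⟨G n, (F n)ᶜ, (hG n).1, (hF n).1.compl, hn, ?_⟩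
  filter_upwards [(hG n).2, (hF n).2] with C h1 h2
  exact ⟨h1, by rwa [sdiff_compl, inter_comm]⟩

end Bracketing

section EmpiricalFrequency

variable {X Ω : Type*}

/-- The frequency of visits to `C` of the process `X₁ ∘ T^[i]` during its first `n` steps. -/
noncomputable def empiricalFrequency (T : Ω → Ω) (X₁ : Ω → X) (n : ℕ) (ω : Ω) (C : Set X) : ℝ :=
  (n : ℝ)⁻¹ * ∑ i ∈ Finset.range n, Set.indicator C (fun _ => (1 : ℝ)) (X₁ (T^[i] ω))

theorem empiricalFrequency_le_of_orbit {T : Ω → Ω} {X₁ : Ω → X} {ω : Ω} {C D : Set X}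
    (h : ∀ i, X₁ (T^[i] ω) ∉ C \ D) (n : ℕ) :
    empiricalFrequency T X₁ n ω C ≤ empiricalFrequency T X₁ n ω D := by
  refine mul_le_mul_of_nonneg_left (Finset.sum_le_sum fun i _ => ?_) (by positivity)
  by_cases hC : X₁ (T^[i] ω) ∈ C
  · have hD : X₁ (T^[i] ω) ∈ D := by_contra fun hD => h i ⟨hC, hD⟩
    simp [hC, hD]
  · rw [indicator_of_notMem hC]
    exact indicator_nonneg (fun _ _ => zero_le_one) _

theorem tendsto_empiricalFrequency_of_eventually_mem_iff {T : Ω → Ω} {X₁ : Ω → X} {n : ℕ}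
    {ω : Ω} {C : Set X} {g : ℕ → Set X} (hg : ∀ x, ∀ᶠ j in atTop, (x ∈ g j ↔ x ∈ C)) :
    Tendsto (fun j => empiricalFrequency T X₁ n ω (g j)) atTop
      (nhds (empiricalFrequency T X₁ n ω C)) := by
  refine (tendsto_finsetSum _ fun i _ => ?_).const_mul _
  refine tendsto_const_nhds.congr' ?_
  filter_upwards [hg (X₁ (T^[i] ω))] with j hj
  by_cases h : X₁ (T^[i] ω) ∈ C
  · simp [h, hj.2 h]
  · simp [h, mt hj.1 h]

variable [MeasurableSpace X] [MeasurableSpace Ω] {P : Measure Ω} {T : Ω → Ω} {X₁ : Ω → X}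

theorem ae_forall_orbit_notMem (hT : MeasurePreserving T P P) (hX₁ : Measurable X₁) {N : Set X}
    (hN : Measure.map X₁ P N = 0) : ∀ᵐ ω ∂P, ∀ i, X₁ (T^[i] ω) ∉ N :=
  ae_all_iff.2 fun i => (hT.iterate i).quasiMeasurePreserving.ae
    (ae_of_ae_map hX₁.aemeasurable (measure_eq_zero_iff_ae_notMem.1 hN))

theorem ae_tendsto_empiricalFrequency [IsProbabilityMeasure P] (hT : Ergodic T P)
    (hX₁ : Measurable X₁) {C : Set X} (hC : MeasurableSet C) :
    ∀ᵐ ω ∂P, Tendsto (fun n => empiricalFrequency T X₁ n ω C) atTop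
      (nhds ((Measure.map X₁ P).real C)) := by
  have hind : (fun ω => C.indicator (fun _ => (1 : ℝ)) (X₁ ω)) =
      (X₁ ⁻¹' C).indicator fun _ => 1 := rfl
  have h := hT.ae_tendsto_birkhoffAverage (f := fun ω => C.indicator (fun _ => (1 : ℝ)) (X₁ ω))
    ((measurable_const.indicator hC).comp hX₁)
    (hind ▸ (integrable_const 1).indicator (hX₁ hC))
  rw [hind, integral_indicator_const _ (hX₁ hC), smul_eq_mul, mul_one,
    ← map_measureReal_apply hX₁ hC] at h
  exact h

/-- A countable class covered by one small bracket has uniformly small discrepancy. -/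
theorem ae_eventually_discrepancy_le_of_bracket [IsProbabilityMeasure P] (hT : Ergodic T P)
    (hX₁ : Measurable X₁) {𝒟 : Set (Set X)} (h𝒟 : 𝒟.Countable) {L H : Set X}
    (hL : MeasurableSet L) (hH : MeasurableSet H) {ε : ℝ} (hε : 0 < ε)
    (hLH : Measure.map X₁ P (H \ L) ≤ ENNReal.ofReal (ε / 2))
    (hbr : ∀ C ∈ 𝒟, Measure.map X₁ P (L \ C) = 0 ∧ Measure.map X₁ P (C \ H) = 0) :
    ∀ᵐ ω ∂P, ∀ᶠ n in atTop, ∀ C ∈ 𝒟,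
      |empiricalFrequency T X₁ n ω C - (Measure.map X₁ P).real C| ≤ ε := by
  have : IsProbabilityMeasure (Measure.map X₁ P) :=
    Measure.isProbabilityMeasure_map hX₁.aemeasurable
  have hreal_le {A B : Set X} (h : Measure.map X₁ P (A \ B) = 0) :
      (Measure.map X₁ P).real A ≤ (Measure.map X₁ P).real B :=
    ENNReal.toReal_mono (measure_ne_top _ _) (measure_mono_ae (ae_le_set.2 h))
  have hHL : (Measure.map X₁ P).real H ≤ (Measure.map X₁ P).real L + ε / 2 := by
    have h1 : (Measure.map X₁ P).real (H \ L) ≤ ε / 2 :=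
      ENNReal.toReal_le_of_le_ofReal (by positivity) hLH
    have h2 : (Measure.map X₁ P).real H ≤ (Measure.map X₁ P).real (L ∪ H \ L) :=
      measureReal_mono (by simp)
    have h3 := measureReal_union_le (μ := Measure.map X₁ P) L (H \ L)
    linarith
  have horbit : ∀ᵐ ω ∂P, ∀ C ∈ 𝒟,
      (∀ i, X₁ (T^[i] ω) ∉ L \ C) ∧ ∀ i, X₁ (T^[i] ω) ∉ C \ H :=
    (ae_ball_iff h𝒟).2 fun C hC =>
      (ae_forall_orbit_notMem hT.toMeasurePreserving hX₁ (hbr C hC).1).and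
        (ae_forall_orbit_notMem hT.toMeasurePreserving hX₁ (hbr C hC).2)
  filter_upwards [horbit, ae_tendsto_empiricalFrequency hT hX₁ hL,
    ae_tendsto_empiricalFrequency hT hX₁ hH] with ω hω hωL hωH
  filter_upwards [hωL.eventually_const_le (sub_lt_self _ (half_pos hε)),
    hωH.eventually_le_const (lt_add_of_pos_right _ (half_pos hε))] with n hnL hnH C hC
  have h1 := empiricalFrequency_le_of_orbit (hω C hC).1 n
  have h2 := empiricalFrequency_le_of_orbit (hω C hC).2 n
  have h3 := hreal_le (hbr C hC).1
  have h4 := hreal_le (hbr C hC).2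
  rw [abs_le]
  constructor <;> linarith

theorem FiniteVC.ae_eventually_discrepancy_le [IsProbabilityMeasure P] (hT : Ergodic T P)
    (hX₁ : Measurable X₁) {𝒞 𝒟 : Set (Set X)} (hVC : FiniteVC 𝒞)
    (h𝒞 : ∀ C ∈ 𝒞, MeasurableSet C) (h𝒟 : 𝒟.Countable) (h𝒟𝒞 : 𝒟 ⊆ 𝒞) {ε : ℝ} (hε : 0 < ε) :
    ∀ᵐ ω ∂P, ∀ᶠ n in atTop, ∀ C ∈ 𝒟,
      |empiricalFrequency T X₁ n ω C - (Measure.map X₁ P).real C| ≤ ε := by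
  have : IsProbabilityMeasure (Measure.map X₁ P) :=
    Measure.isProbabilityMeasure_map hX₁.aemeasurable
  let p (ℰ : Set (Set X)) : Prop := ∀ᵐ ω ∂P, ∀ᶠ n in atTop, ∀ C ∈ 𝒟 ∩ ℰ,
    |empiricalFrequency T X₁ n ω C - (Measure.map X₁ P).real C| ≤ ε
  have hmono : ∀ t, p t → ∀ s ⊆ t, p s := fun t ht s hst => by
    filter_upwards [ht] with ω hω
    filter_upwards [hω] with n hn C hC
    exact hn C ⟨hC.1, hst hC.2⟩
  let F : Filter (Set X) := comk p (by simp [p]) hmono fun s hs t ht => by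
    filter_upwards [hs, ht] with ω hωs hωt
    filter_upwards [hωs, hωt] with n hns hnt C hC
    exact hC.2.elim (fun h => hns C ⟨hC.1, h⟩) fun h => hnt C ⟨hC.1, h⟩
  suffices p univ by simpa [p] using this
  by_contra hp
  have hF : F.NeBot := neBot_iff.2 fun h => hp <| by
    have : (∅ : Set (Set X)) ∈ F := h ▸ mem_bot
    simpa only [compl_empty] using mem_comk.1 this
  have h𝒟F : 𝒟 ∈ Ultrafilter.of F := Ultrafilter.of_le F <| by
    refine mem_comk.2 (ae_of_all _ fun ω => .of_forall fun n C hC => ?_)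
    exact absurd hC.1 hC.2
  obtain ⟨L, H, hL, hH, hLH, hbr⟩ := hVC.exists_bracket_of_ultrafilter
    (μ := Measure.map X₁ P) h𝒞 (mem_of_superset h𝒟F h𝒟𝒞)
    (ENNReal.ofReal_pos.2 (half_pos hε))
  have hpbr : p {C | Measure.map X₁ P (L \ C) = 0 ∧ Measure.map X₁ P (C \ H) = 0} :=
    ae_eventually_discrepancy_le_of_bracket hT hX₁ (h𝒟.mono inter_subset_left) hL hH hε hLH
      fun C hC => hC.2
  exact Ultrafilter.compl_notMem_iff.2 hbr (Ultrafilter.of_le F (compl_mem_comk.2 hpbr))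

end EmpiricalFrequency

/-- **Theorem 3 (ergodic ULLN for VC classes).** If `𝒞` is a separable VC class of
measurable sets and `X_n = X₁ ∘ T^(n-1)` is a stationary ergodic process with marginal
distribution `μ`, then the empirical discrepancy over `𝒞` tends to `0` almost surely. -/
theorem ergodic_ulln_vc {X : Type*} [MeasurableSpace X] (𝒞 : Set (Set X))
    (h𝒞 : ∀ C ∈ 𝒞, MeasurableSet C) (hsep : SeparableSetFamily 𝒞) (hVC : FiniteVC 𝒞)
    {Ω : Type*} [MeasurableSpace Ω] (ℙ : Measure Ω) [IsProbabilityMeasure ℙ]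
    (T : Ω → Ω) (hT : Ergodic T ℙ) (X₁ : Ω → X) (hX₁ : Measurable X₁)
    (μ : Measure X) (hμ : Measure.map X₁ ℙ = μ) :
    ∀ᵐ ω ∂ℙ, Filter.Tendsto
      (fun n : ℕ => ⨆ C : 𝒞, |(n : ℝ)⁻¹ * ∑ i ∈ Finset.range n,
          Set.indicator (C : Set X) (fun _ => (1 : ℝ)) (X₁ (T^[i] ω)) -
        (μ (C : Set X)).toReal|)
      Filter.atTop (nhds 0) := by
  subst hμ
  obtain ⟨𝒞₀, h𝒞₀, hcount, hlim⟩ := hsep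
  have : IsProbabilityMeasure (Measure.map X₁ ℙ) :=
    Measure.isProbabilityMeasure_map hX₁.aemeasurable
  have hpos (k : ℕ) : (0 : ℝ) < 1 / ((k : ℝ) + 1) := Nat.one_div_pos_of_nat
  filter_upwards [ae_all_iff.2 fun k : ℕ =>
    hVC.ae_eventually_discrepancy_le hT hX₁ h𝒞 hcount h𝒞₀ (hpos k)] with ω hω
  refine Metric.tendsto_atTop'.2 fun ε hε => ?_
  obtain ⟨k, hk⟩ := exists_nat_one_div_lt hε
  obtain ⟨N, hN⟩ := eventually_atTop.1 (hω k)
  refine ⟨N, fun n hn => ?_⟩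
  rw [Real.dist_0_eq_abs, abs_of_nonneg (Real.iSup_nonneg fun _ => abs_nonneg _)]
  refine (Real.iSup_le (fun C => ?_) (hpos k).le).trans_lt hk
  obtain ⟨g, hg, hgC⟩ := hlim C C.2
  have hμg : Tendsto (fun j => (Measure.map X₁ ℙ).real (g j)) atTop
      (nhds ((Measure.map X₁ ℙ).real C)) :=
    (ENNReal.tendsto_toReal (measure_ne_top _ _)).comp <|
      tendsto_measure_of_tendsto_indicator_of_isFiniteMeasure atTop _
        (fun j => h𝒞 _ (h𝒞₀ (hg j))) hgC
  exact le_of_tendsto'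
    ((tendsto_empiricalFrequency_of_eventually_mem_iff hgC).sub hμg).abs
    fun j => hN n hn.le (g j) (hg j)
end

section
/- Let (𝒳, 𝒮, μ) be a probability space and let 𝒞 ⊆ 𝒮 be a countable family. Suppose there exists η > 0 such that for every finite measurable partition π of 𝒳, sup_{C ∈ 𝒞} μ(∂(C : π)) > η. Then for every integer L ≥ 1 there exist L Boolean independent sets in 𝒞; in particular the dual VC dimension of 𝒞 is infinite. -/
open MeasureTheory Set Filter

/-- The sets `A 0, …, A (k-1)` are Boolean independent: all `2^k` basic intersections
formed from the `A i` and their complements are nonempty. -/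
def BooleanIndep {X : Type*} {k : ℕ} (A : Fin k → Set X) : Prop :=
  ∀ σ : Fin k → Bool, (⋂ i, (if σ i = true then A i else (A i)ᶜ)).Nonempty

/-- `𝒞` has finite dual VC dimension: the sizes of Boolean independent subfamilies of `𝒞`
are bounded. -/
def FiniteDualVC {X : Type*} (𝒞 : Set (Set X)) : Prop :=
  ∃ k : ℕ, ∀ m : ℕ, ∀ A : Fin m → Set X,
    Function.Injective A → (∀ i, A i ∈ 𝒞) → BooleanIndep A → m ≤ k

/-- `A` is asymptotically null for the sets `E i` along `l`: `μ (A ∩ E i)` tends to `0`. -/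
def AsymptoticallyNull {X ι : Type*} [MeasurableSpace X] (μ : Measure X) (l : Filter ι)
    (E : ι → Set X) (A : Set X) : Prop :=
  ∀ ε : ENNReal, 0 < ε → ∀ᶠ i in l, μ (A ∩ E i) ≤ ε

namespace AsymptoticallyNull

variable {X ι : Type*} [MeasurableSpace X] {μ : Measure X} {l : Filter ι} {E : ι → Set X}

theorem of_measure_zero {A : Set X} (hA : μ A = 0) : AsymptoticallyNull μ l E A :=
  fun _ _ => .of_forall fun _ => (measure_inter_null_of_null_left _ hA).trans_le zero_le

theorem union {A B : Set X} (hA : AsymptoticallyNull μ l E A)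
    (hB : AsymptoticallyNull μ l E B) : AsymptoticallyNull μ l E (A ∪ B) := by
  intro ε hε
  filter_upwards [hA (ε / 2) (ENNReal.half_pos hε.ne'), hB (ε / 2) (ENNReal.half_pos hε.ne')]
    with i h₁ h₂
  rw [union_inter_distrib_right, ← ENNReal.add_halves ε]
  exact (measure_union_le _ _).trans (add_le_add h₁ h₂)

theorem accumulate {A : ℕ → Set X} (hA : ∀ n, AsymptoticallyNull μ l E (A n)) (n : ℕ) :
    AsymptoticallyNull μ l E (Set.accumulate A n) := by
  induction n with
  | zero => simpa using hA 0
  | succ n ih => rw [Set.accumulate_succ]; exact ih.union (hA _)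

theorem iUnion [IsFiniteMeasure μ] {A : ℕ → Set X} (hm : ∀ n, MeasurableSet (A n))
    (hA : ∀ n, AsymptoticallyNull μ l E (A n)) : AsymptoticallyNull μ l E (⋃ n, A n) := by
  intro ε hε
  have hε2 : 0 < ε / 2 := ENNReal.half_pos hε.ne'
  have hmacc : ∀ n, MeasurableSet (Set.accumulate A n) := fun n =>
    .biUnion (to_countable _) fun i _ => hm i
  have hsub : ∀ n, Set.accumulate A n ⊆ ⋃ n, A n := Set.accumulate_subset_iUnion
  have hlim : Tendsto (fun n => μ (Set.accumulate A n) + ε / 2) atTop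
      (nhds (μ (⋃ n, A n) + ε / 2)) := tendsto_measure_iUnion_accumulate.add_const _
  obtain ⟨n, hn⟩ : ∃ n, μ (⋃ n, A n) ≤ μ (Set.accumulate A n) + ε / 2 := by
    by_cases htop : ε = ⊤
    · exact ⟨0, by simp [htop, ENNReal.top_div]⟩
    · exact ((hlim.eventually_const_lt
        (ENNReal.lt_add_right (measure_ne_top _ _) hε2.ne')).exists).imp fun _ h => h.le
  have hdiff : μ ((⋃ n, A n) \ Set.accumulate A n) ≤ ε / 2 := by
    rw [measure_sdiff (hsub n) (hmacc n).nullMeasurableSet (measure_ne_top _ _)]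
    exact tsub_le_iff_left.2 hn
  filter_upwards [accumulate hA n (ε / 2) hε2] with i hi
  calc μ ((⋃ n, A n) ∩ E i)
      ≤ μ ((Set.accumulate A n ∩ E i) ∪ ((⋃ n, A n) \ Set.accumulate A n)) := by
        refine measure_mono fun x hx => ?_
        by_cases h : x ∈ Set.accumulate A n
        · exact .inl ⟨h, hx.2⟩
        · exact .inr ⟨hx.1, h⟩
    _ ≤ ε / 2 + ε / 2 := (measure_union_le _ _).trans (add_le_add hi hdiff)
    _ = ε := ENNReal.add_halves ε

/-- There is a largest asymptotically null set, up to measure zero. -/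
theorem exists_maximal [IsFiniteMeasure μ] (l : Filter ι) (E : ι → Set X) :
    ∃ G, MeasurableSet G ∧ AsymptoticallyNull μ l E G ∧
      ∀ A, MeasurableSet A → AsymptoticallyNull μ l E A → Disjoint G A → μ A = 0 := by
  set S : Set ENNReal := μ '' {A | MeasurableSet A ∧ AsymptoticallyNull μ l E A} with hS
  have hne : S.Nonempty := ⟨_, ∅, ⟨.empty, of_measure_zero measure_empty⟩, rfl⟩
  obtain ⟨u, -, hu, huS⟩ := exists_seq_tendsto_sSup hne (OrderTop.bddAbove S)
  choose A hA hAu using huS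
  refine ⟨⋃ n, A n, .iUnion fun n => (hA n).1, iUnion (fun n => (hA n).1) fun n => (hA n).2, ?_⟩
  intro B hBm hB hdisj
  have hle : sSup S ≤ μ (⋃ n, A n) := le_of_tendsto' hu fun n =>
    (hAu n).symm.trans_le (measure_mono (subset_iUnion A n))
  have hmem : μ ((⋃ n, A n) ∪ B) ≤ sSup S := le_sSup ⟨_, ⟨(MeasurableSet.iUnion fun n =>
    (hA n).1).union hBm, (iUnion (fun n => (hA n).1) fun n => (hA n).2).union hB⟩, rfl⟩
  rw [measure_union hdisj hBm] at hmem
  have := hmem.trans hle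
  by_contra h
  exact (ENNReal.lt_add_right (measure_ne_top μ _) h).not_ge this

end AsymptoticallyNull

/-- The partition into the atoms of the algebra generated by the members of `F`. -/
def atomPartition {X : Type*} [MeasurableSpace X] (F : Finset {A : Set X // MeasurableSet A}) :
    Set (Set X) :=
  range fun σ : F → Prop => (fun x (A : F) => x ∈ A.1.1) ⁻¹' {σ}

theorem isFinitePartition_atomPartition {X : Type*} [MeasurableSpace X]
    (F : Finset {A : Set X // MeasurableSet A}) : IsFinitePartition (atomPartition F) := by
  refine ⟨finite_range _, ?_, ?_, ?_⟩
  · rintro _ ⟨σ, rfl⟩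
    exact (measurable_pi_lambda _ fun A => measurable_mem.2 A.1.2) (measurableSet_singleton σ)
  · rintro _ ⟨σ, rfl⟩ _ ⟨τ, rfl⟩ hne
    refine Disjoint.preimage _ (disjoint_singleton.2 ?_)
    rintro rfl
    exact hne rfl
  · exact eq_univ_of_forall fun x => ⟨_, ⟨_, rfl⟩, rfl⟩

theorem subset_of_mem_atomPartition {X : Type*} [MeasurableSpace X]
    {F : Finset {A : Set X // MeasurableSet A}} {A : {A : Set X // MeasurableSet A}} (hA : A ∈ F)
    {B : Set X} (hB : B ∈ atomPartition F) {x : X} (hxA : x ∈ A.1) (hxB : x ∈ B) : B ⊆ A.1 := by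
  obtain ⟨σ, rfl⟩ := hB
  intro y hy
  have h := congrFun ((hxB : _ = σ).trans (hy : _ = σ).symm) ⟨A, hA⟩
  exact h.mp hxA

/-- If `A` is a union of atoms of `F` and meets the boundary of `C`, then `C` splits `A`. -/
theorem measure_pos_of_inter_piBoundary {X : Type*} [MeasurableSpace X] {μ : Measure X}
    {F : Finset {A : Set X // MeasurableSet A}} {A : {A : Set X // MeasurableSet A}} (hA : A ∈ F)
    {C : Set X} (h : (A.1 ∩ piBoundary μ (atomPartition F) C).Nonempty) :
    0 < μ (A.1 ∩ C) ∧ 0 < μ (A.1 ∩ Cᶜ) := by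
  obtain ⟨x, hxA, B, ⟨hB, hpos⟩, hxB⟩ := h
  have hBA := subset_of_mem_atomPartition hA hB hxA hxB
  obtain ⟨h₁, h₂⟩ := mul_ne_zero_iff.1 hpos.ne'
  exact ⟨(pos_iff_ne_zero.2 h₁).trans_le (measure_mono (inter_subset_inter_left _ hBA)),
    (pos_iff_ne_zero.2 h₂).trans_le (measure_mono (inter_subset_inter_left _ hBA))⟩

theorem BooleanIndep.injective {X : Type*} {k : ℕ} {A : Fin k → Set X} (hA : BooleanIndep A) :
    Function.Injective A := by
  intro i j hij
  by_contra hne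
  obtain ⟨x, hx⟩ := hA fun m => decide (m = i)
  have hi := mem_iInter.1 hx i
  have hj := mem_iInter.1 hx j
  simp only [decide_true, if_true] at hi
  simp only [decide_eq_true_eq, Ne.symm hne, if_false] at hj
  exact hj (hij ▸ hi)

/-- If the members of `𝒞` simultaneously split any finitely many measurable subsets of `H` of
positive measure, then `𝒞` contains arbitrarily long sequences all of whose basic intersections
meet `H` in positive measure. -/
theorem exists_forall_measure_iInter_pos {X : Type*} [MeasurableSpace X] {μ : Measure X}
    {𝒞 : Set (Set X)} (h𝒞 : ∀ C ∈ 𝒞, MeasurableSet C) {H : Set X} (hHm : MeasurableSet H)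
    (hH : 0 < μ H)
    (hsplit : ∀ k : ℕ, ∀ S : (Fin k → Bool) → Set X, (∀ σ, MeasurableSet (S σ)) →
      (∀ σ, S σ ⊆ H) → (∀ σ, 0 < μ (S σ)) →
      ∃ C ∈ 𝒞, ∀ σ, 0 < μ (S σ ∩ C) ∧ 0 < μ (S σ ∩ Cᶜ)) (L : ℕ) :
    ∃ A : Fin L → Set X, (∀ i, A i ∈ 𝒞) ∧
      ∀ σ : Fin L → Bool, 0 < μ (H ∩ ⋂ i, if σ i = true then A i else (A i)ᶜ) := by
  induction L with
  | zero => exact ⟨Fin.elim0, fun i => i.elim0, fun σ => by simpa using hH⟩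
  | succ L ih =>
    obtain ⟨A, hA𝒞, hA⟩ := ih
    obtain ⟨C, hC, hsp⟩ := hsplit L (fun σ => H ∩ ⋂ i, if σ i = true then A i else (A i)ᶜ)
      (fun σ => hHm.inter <| .iInter fun i => by
        split_ifs
        · exact h𝒞 _ (hA𝒞 i)
        · exact (h𝒞 _ (hA𝒞 i)).compl)
      (fun σ => inter_subset_left) hA
    refine ⟨Fin.cons C A, Fin.cases hC hA𝒞, fun σ => ?_⟩
    have key := hsp fun i => σ i.succ
    have heq : (H ∩ ⋂ i, if σ i = true then (Fin.cons C A : Fin (L + 1) → Set X) i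
          else ((Fin.cons C A : Fin (L + 1) → Set X) i)ᶜ) =
        (H ∩ ⋂ i : Fin L, if σ i.succ = true then A i else (A i)ᶜ) ∩
          (if σ 0 = true then C else Cᶜ) := by
      ext x
      simp only [mem_inter_iff, mem_iInter, Fin.forall_fin_succ, Fin.cons_zero, Fin.cons_succ]
      tauto
    rw [heq]
    split_ifs
    · exact key.1
    · exact key.2

/-- If a countable family `𝒞` fails finite approximation at level `η > 0` for every finite
measurable partition, then `𝒞` contains Boolean independent subfamilies of every finite
size; in particular, its dual VC dimension is infinite. -/
theorem boolean_independent_of_not_approximable {X : Type*} [MeasurableSpace X]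
    (μ : Measure X) [IsProbabilityMeasure μ] (𝒞 : Set (Set X))
    (h𝒞 : ∀ C ∈ 𝒞, MeasurableSet C) (hcount : 𝒞.Countable)
    (η : ENNReal) (hη : 0 < η)
    (hbd : ∀ π : Set (Set X), IsFinitePartition π →
      η < ⨆ C ∈ 𝒞, μ (piBoundary μ π C)) :
    (∀ L : ℕ, 1 ≤ L → ∃ A : Fin L → Set X, Function.Injective A ∧
      (∀ i, A i ∈ 𝒞) ∧ BooleanIndep A) ∧ ¬ FiniteDualVC 𝒞 := by
  classical
  suffices h : ∀ L : ℕ, ∃ A : Fin L → Set X, Function.Injective A ∧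
      (∀ i, A i ∈ 𝒞) ∧ BooleanIndep A by
    refine ⟨fun L _ => h L, fun ⟨k, hk⟩ => ?_⟩
    obtain ⟨A, hinj, hA𝒞, hA⟩ := h (k + 1)
    exact (Nat.lt_succ_self k).not_ge (hk _ A hinj hA𝒞 hA)
  have hC : ∀ F : Finset {A : Set X // MeasurableSet A},
      ∃ C ∈ 𝒞, η < μ (piBoundary μ (atomPartition F) C) := fun F => by
    simpa only [lt_iSup_iff, exists_prop] using hbd _ (isFinitePartition_atomPartition F)
  choose C hC𝒞 hCη using hC
  let U : Ultrafilter (Finset {A : Set X // MeasurableSet A}) := Ultrafilter.of atTop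
  let E := fun F => piBoundary μ (atomPartition F) (C F)
  obtain ⟨G, hGm, hG, hGmax⟩ := AsymptoticallyNull.exists_maximal (μ := μ) (U : Filter _) E
  have hpos : 0 < μ Gᶜ := by
    refine pos_iff_ne_zero.2 fun h0 => ?_
    obtain ⟨F, hF⟩ := ((hG.union (.of_measure_zero h0)) η hη).exists
    rw [union_compl_self, univ_inter] at hF
    exact (hCη F).not_ge hF
  have hsplit : ∀ k : ℕ, ∀ S : (Fin k → Bool) → Set X, (∀ σ, MeasurableSet (S σ)) →
      (∀ σ, S σ ⊆ Gᶜ) → (∀ σ, 0 < μ (S σ)) →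
      ∃ C ∈ 𝒞, ∀ σ, 0 < μ (S σ ∩ C) ∧ 0 < μ (S σ ∩ Cᶜ) := by
    intro k S hSm hSG hS
    have hev : ∀ᶠ F in (U : Filter _), ∀ σ, ⟨S σ, hSm σ⟩ ∈ F ∧ (S σ ∩ E F).Nonempty := by
      refine eventually_all.2 fun σ => Eventually.and ?_ ?_
      · refine Ultrafilter.of_le atTop ?_
        filter_upwards [eventually_ge_atTop {⟨S σ, hSm σ⟩}] with F hF
        exact Finset.singleton_subset_iff.1 hF
      · by_contra hcon
        refine (hS σ).ne' (hGmax _ (hSm σ) (fun ε hε => ?_)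
          (disjoint_left.2 fun x hxG hxS => hSG σ hxS hxG))
        filter_upwards [Ultrafilter.eventually_not.2 hcon] with F hF
        simp [not_nonempty_iff_eq_empty.1 hF]
    obtain ⟨F, hF⟩ := hev.exists
    exact ⟨C F, hC𝒞 F, fun σ => measure_pos_of_inter_piBoundary (hF σ).1 (hF σ).2⟩
  intro L
  obtain ⟨A, hA𝒞, hA⟩ := exists_forall_measure_iInter_pos h𝒞 hGm.compl hpos hsplit L
  have hind : BooleanIndep A := fun σ =>
    (nonempty_of_measure_ne_zero (hA σ).ne').mono inter_subset_right
  exact ⟨A, hind.injective, hA𝒞, hind⟩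
end

section
/- Let ℱ be a separable family of measurable functions f : 𝒳 → [0,1] and let 𝒢(ℱ) = {G_f : f ∈ ℱ} be the family of graphs, where G_f = {(x, s) : x ∈ 𝒳, 0 ≤ s ≤ f(x)} ⊆ 𝒳 × [0,1]. If dim(𝒢(ℱ)) < ∞, then for every probability measure μ on (𝒳, 𝒮) and every ε > 0, N_[](ε, ℱ, μ) < ∞. -/
open MeasureTheory Set Filter

/-- `𝒞` is covered on `A`, up to null sets, by finitely many brackets whose gaps have
measure at most `c`: each `C ∈ 𝒞` agrees almost everywhere on `A \ p.2` with `p.1` for one of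
finitely many pairs `p`. -/
def BracketedOn {Y : Type*} [MeasurableSpace Y] (ρ : Measure Y) (𝒞 : Set (Set Y))
    (A : Set Y) (c : ℝ) : Prop :=
  ∃ S : Set (Set Y × Set Y), S.Finite ∧
    (∀ p ∈ S, MeasurableSet p.1 ∧ MeasurableSet p.2 ∧ ρ.real (A ∩ p.2) ≤ c) ∧
    ∀ C ∈ 𝒞, ∃ p ∈ S, ∀ᵐ y ∂ρ, y ∈ A → y ∉ p.2 → (y ∈ C ↔ y ∈ p.1)

namespace BracketedOn

variable {Y : Type*} [MeasurableSpace Y] {ρ : Measure Y} {𝒞 : Set (Set Y)} {A B : Set Y} {c d : ℝ}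

theorem mono (h : BracketedOn ρ 𝒞 A c) (hcd : c ≤ d) : BracketedOn ρ 𝒞 A d := by
  obtain ⟨S, hS, hm, hC⟩ := h
  exact ⟨S, hS, fun p hp => ⟨(hm p hp).1, (hm p hp).2.1, (hm p hp).2.2.trans hcd⟩, hC⟩

theorem of_measureReal_le (h : ρ.real A ≤ c) : BracketedOn ρ 𝒞 A c :=
  ⟨{(∅, univ)}, finite_singleton _, by simpa using h, fun C _ => ⟨_, rfl, by simp⟩⟩

theorem union [IsFiniteMeasure ρ] (hA : MeasurableSet A) (hB : MeasurableSet B)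
    (hAB : Disjoint A B) (h₁ : BracketedOn ρ 𝒞 A c) (h₂ : BracketedOn ρ 𝒞 B d) :
    BracketedOn ρ 𝒞 (A ∪ B) (c + d) := by
  obtain ⟨S, hS, hSm, hSC⟩ := h₁
  obtain ⟨T, hT, hTm, hTC⟩ := h₂
  refine ⟨image2 (fun p q => (p.1 ∩ A ∪ q.1 ∩ B, p.2 ∩ A ∪ q.2 ∩ B)) S T, hS.image2 _ hT, ?_, ?_⟩
  · rintro _ ⟨p, hp, q, hq, rfl⟩
    refine ⟨((hSm p hp).1.inter hA).union ((hTm q hq).1.inter hB),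
      ((hSm p hp).2.1.inter hA).union ((hTm q hq).2.1.inter hB), ?_⟩
    have hsub : (A ∪ B) ∩ (p.2 ∩ A ∪ q.2 ∩ B) ⊆ (A ∩ p.2) ∪ (B ∩ q.2) := by
      rintro y ⟨-, ⟨h1, h2⟩ | ⟨h1, h2⟩⟩
      exacts [Or.inl ⟨h2, h1⟩, Or.inr ⟨h2, h1⟩]
    exact (measureReal_mono hsub).trans <| (measureReal_union_le _ _).trans <|
      add_le_add (hSm p hp).2.2 (hTm q hq).2.2
  · intro C hC
    obtain ⟨p, hp, hpC⟩ := hSC C hC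
    obtain ⟨q, hq, hqC⟩ := hTC C hC
    refine ⟨_, ⟨p, hp, q, hq, rfl⟩, ?_⟩
    filter_upwards [hpC, hqC] with y h1 h2
    have := fun h : y ∈ A => disjoint_left.1 hAB h
    simp only [mem_union, mem_inter_iff]
    tauto

theorem refine [IsFiniteMeasure ρ] (h : BracketedOn ρ 𝒞 A c)
    (hd : ∀ E, MeasurableSet E → ρ.real (A ∩ E) ≤ c → BracketedOn ρ 𝒞 (A ∩ E) d) :
    BracketedOn ρ 𝒞 A d := by
  obtain ⟨S, hS, hSm, hSC⟩ := h
  have hex : ∀ p ∈ S, BracketedOn ρ 𝒞 (A ∩ p.2) d := fun p hp =>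
    hd _ (hSm p hp).2.1 (hSm p hp).2.2
  choose! T hT hTm hTC using hex
  refine ⟨⋃ p ∈ S, (fun q => (p.1 \ p.2 ∪ q.1 ∩ p.2, p.2 ∩ q.2)) '' T p,
    hS.biUnion fun p hp => (hT p hp).image _, ?_, ?_⟩
  · intro r hr
    simp only [mem_iUnion] at hr
    obtain ⟨p, hp, q, hq, rfl⟩ := hr
    obtain ⟨h1, h2, h3⟩ := hTm p hp q hq
    obtain ⟨h4, h5, -⟩ := hSm p hp
    exact ⟨(h4.diff h5).union (h1.inter h5), h5.inter h2, by rwa [← inter_assoc]⟩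
  · intro C hC
    obtain ⟨p, hp, hpC⟩ := hSC C hC
    obtain ⟨q, hq, hqC⟩ := hTC p hp C hC
    refine ⟨_, mem_biUnion hp ⟨q, hq, rfl⟩, ?_⟩
    filter_upwards [hpC, hqC] with y h1 h2
    simp only [mem_union, mem_inter_iff, Set.mem_sdiff] at *
    tauto

theorem biUnion_finset [IsFiniteMeasure ρ] {r : ℝ} (F : Finset (Set Y))
    (hm : ∀ D ∈ F, MeasurableSet D) (hd : (F : Set (Set Y)).PairwiseDisjoint id)
    (h : ∀ D ∈ F, BracketedOn ρ 𝒞 D (r * ρ.real D)) :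
    BracketedOn ρ 𝒞 (⋃ D ∈ F, D) (r * ρ.real (⋃ D ∈ F, D)) := by
  classical
  induction F using Finset.induction_on with
  | empty => exact of_measureReal_le (by simp)
  | insert D F hD ih =>
    simp only [Finset.mem_insert, forall_eq_or_imp] at hm h
    have hdis : Disjoint D (⋃ D ∈ F, D) := by
      rw [disjoint_iUnion₂_right]
      intro D' hD'
      exact hd (by simp) (by simp [hD']) (by rintro rfl; exact hD hD')
    have hmF : MeasurableSet (⋃ D ∈ F, D) := F.measurableSet_biUnion hm.2
    rw [Finset.set_biUnion_insert, measureReal_union hdis hmF (measure_ne_top _ _) (measure_ne_top _ _),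
      mul_add]
    exact h.1.union hm.1 hmF hdis (ih hm.2 (hd.subset (by simp)) h.2)

/-- A uniform relative bound on all measurable sets can be iterated to an arbitrarily small one. -/
theorem of_forall_mul [IsFiniteMeasure ρ] {r : ℝ} (hr0 : 0 ≤ r) (hr : r < 1)
    (h : ∀ A, MeasurableSet A → BracketedOn ρ 𝒞 A (r * ρ.real A)) (hA : MeasurableSet A)
    (hc : 0 < c) : BracketedOn ρ 𝒞 A c := by
  have hpow : ∀ n : ℕ, BracketedOn ρ 𝒞 A (r ^ n * ρ.real A) := by
    intro n
    induction n with
    | zero => exact of_measureReal_le (by simp)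
    | succ n ih =>
      refine ih.refine fun E hE hle => (h _ (hA.inter hE)).mono ?_
      calc r * ρ.real (A ∩ E) ≤ r * (r ^ n * ρ.real A) := by gcongr
        _ = r ^ (n + 1) * ρ.real A := by ring
  have hlim : Tendsto (fun n : ℕ => r ^ n * ρ.real A) atTop (nhds 0) := by
    simpa using (tendsto_pow_atTop_nhds_zero_of_lt_one hr0 hr).mul_const (ρ.real A)
  obtain ⟨n, hn⟩ := (hlim.eventually (gt_mem_nhds hc)).exists
  exact (hpow n).mono hn.le

/-- If no member of `𝒞` cuts all cells `D i`, all of measure `t`, then `⋃ i, D i` can be bracketed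
with gaps of the form `(⋃ i, D i) \ D j`. -/
theorem of_not_split [IsFiniteMeasure ρ] {ι : Type*} [Fintype ι] {D : ι → Set Y} {t r : ℝ}
    (hm : ∀ i, MeasurableSet (D i)) (ht : ∀ i, ρ.real (D i) = t)
    (hr : ρ.real (⋃ i, D i) - t ≤ r)
    (h : ∀ C ∈ 𝒞, ∃ i, ρ (D i ∩ C) = 0 ∨ ρ (D i \ C) = 0) :
    BracketedOn ρ 𝒞 (⋃ i, D i) r := by
  refine ⟨range (fun i => (∅, (D i)ᶜ)) ∪ range (fun i => (univ, (D i)ᶜ)),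
    (finite_range _).union (finite_range _), ?_, ?_⟩
  · have hle : ∀ i, ρ.real ((⋃ i, D i) ∩ (D i)ᶜ) ≤ r := by
      intro i
      rw [← sdiff_eq, measureReal_sdiff (subset_iUnion _ _) (hm i), ht i]
      exact hr
    rintro _ (⟨i, rfl⟩ | ⟨i, rfl⟩)
    exacts [⟨.empty, (hm i).compl, hle i⟩, ⟨.univ, (hm i).compl, hle i⟩]
  · intro C hC
    obtain ⟨i, hi | hi⟩ := h C hC
    · refine ⟨_, Or.inl ⟨i, rfl⟩, ?_⟩
      filter_upwards [measure_eq_zero_iff_ae_notMem.1 hi] with y hy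
      simp only [mem_inter_iff, mem_compl_iff, mem_empty_iff_false] at *
      tauto
    · refine ⟨_, Or.inr ⟨i, rfl⟩, ?_⟩
      filter_upwards [measure_eq_zero_iff_ae_notMem.1 hi] with y hy
      simp only [Set.mem_sdiff, mem_compl_iff, mem_univ] at *
      tauto

end BracketedOn

/-- Exhaustion: if every non-null measurable subset of `A` contains a non-null measurable set
satisfying `P`, then finitely many disjoint sets satisfying `P` fill `A` up to measure `η`. -/
theorem exists_finset_disjoint_exhaustion {Y : Type*} [MeasurableSpace Y] {ρ : Measure Y}
    [IsFiniteMeasure ρ] {A : Set Y} (hA : MeasurableSet A) {P : Set Y → Prop}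
    (h : ∀ A' ⊆ A, MeasurableSet A' → 0 < ρ A' → ∃ B ⊆ A', MeasurableSet B ∧ 0 < ρ B ∧ P B)
    {η : ℝ} (hη : 0 < η) :
    ∃ F : Finset (Set Y), (∀ D ∈ F, D ⊆ A ∧ MeasurableSet D ∧ P D) ∧
      (F : Set (Set Y)).PairwiseDisjoint id ∧ ρ.real (A \ ⋃ D ∈ F, D) < η := by
  classical
  obtain ⟨𝒟, ⟨hP, hdisj⟩, hmax⟩ := zorn_subset
    {𝒟 : Set (Set Y) | (∀ D ∈ 𝒟, D ⊆ A ∧ MeasurableSet D ∧ 0 < ρ D ∧ P D) ∧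
      𝒟.PairwiseDisjoint id} (fun K hK hchain => ⟨⋃₀ K,
        ⟨fun D ⟨𝒟, h𝒟, hD⟩ => (hK h𝒟).1 D hD,
          (pairwiseDisjoint_sUnion hchain.directedOn).2 fun 𝒟 h𝒟 => (hK h𝒟).2⟩,
        fun 𝒟 h𝒟 => subset_sUnion_of_mem h𝒟⟩)
  have hcount : Countable 𝒟 := by
    have := Measure.countable_meas_pos_of_disjoint_iUnion (μ := ρ) (As := fun D : 𝒟 => (D : Set Y))
      (fun D => (hP D D.2).2.1) (fun D E hDE => hdisj D.2 E.2 (Subtype.coe_injective.ne hDE))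
    have huniv : {D : 𝒟 | 0 < ρ (D : Set Y)} = univ := eq_univ_of_forall fun D => (hP D D.2).2.2.1
    rw [huniv] at this
    exact countable_univ_iff.1 this
  set U : Finset 𝒟 → Set Y := fun F => ⋃ D ∈ F, (D : Set Y) with hU
  have hUm : ∀ F, MeasurableSet (U F) := fun F => F.measurableSet_biUnion fun D _ => (hP D D.2).2.1
  have hUmono : Monotone U := fun F G hFG => biUnion_subset_biUnion_left hFG
  have hUA : ∀ F, U F ⊆ A := fun F => iUnion₂_subset fun D _ => (hP D D.2).1
  have hnull : ρ (A \ ⋃ F, U F) = 0 := by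
    by_contra hne
    obtain ⟨B, hBA, hBm, hBpos, hBP⟩ := h _ sdiff_subset (hA.diff (.iUnion hUm))
      (pos_iff_ne_zero.2 hne)
    have hdB : ∀ D ∈ 𝒟, Disjoint B D := fun D hD => disjoint_left.2 fun y hy hyD =>
      (hBA hy).2 (mem_iUnion.2 ⟨{⟨D, hD⟩}, by simpa [hU] using ⟨hD, hyD⟩⟩)
    have hB : B ∈ 𝒟 := hmax (y := insert B 𝒟)
      ⟨by
        rintro D (rfl | hD)
        exacts [⟨hBA.trans sdiff_subset, hBm, hBpos, hBP⟩, hP D hD],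
        hdisj.insert fun D hD _ => hdB D hD⟩ (subset_insert _ _) (mem_insert _ _)
    have : B = ∅ := by simpa using hdB B hB
    simp [this] at hBpos
  have hlim : Tendsto (fun F => ρ (A \ U F)) atTop (nhds 0) := by
    rw [← hnull, sdiff_iUnion]
    exact tendsto_measure_iInter_atTop (fun F => (hA.diff (hUm F)).nullMeasurableSet)
      (fun F G hFG => sdiff_subset_sdiff_right (hUmono hFG)) ⟨∅, measure_ne_top _ _⟩
  obtain ⟨F, hF⟩ := (hlim.eventually (gt_mem_nhds (ENNReal.ofReal_pos.2 hη))).exists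
  refine ⟨F.map (Function.Embedding.subtype _), ?_, ?_, ?_⟩
  · intro D hD
    simp only [Finset.mem_map, Function.Embedding.subtype_apply] at hD
    obtain ⟨D, -, rfl⟩ := hD
    exact ⟨(hP D D.2).1, (hP D D.2).2.1, (hP D D.2).2.2.2⟩
  · refine hdisj.subset fun D hD => ?_
    simp only [Finset.coe_map, Function.Embedding.subtype_apply] at hD
    obtain ⟨D, -, rfl⟩ := hD
    exact D.2
  · rw [measureReal_def]
    refine ENNReal.toReal_lt_of_lt_ofReal ?_
    convert hF using 3
    simp [hU]

section Independence

variable {Y : Type*} [MeasurableSpace Y] {ρ : Measure Y} [IsFiniteMeasure ρ] {𝒞 : Set (Set Y)}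
  {A : Set Y}

theorem exists_hereditarily_not_bracketedOn {c r : ℝ} (hr0 : 0 ≤ r) (hr : r < 1) (hc : 0 < c)
    (hA : MeasurableSet A) (h : ¬ BracketedOn ρ 𝒞 A c) :
    ∃ A₀, MeasurableSet A₀ ∧ 0 < ρ A₀ ∧
      ∀ B ⊆ A₀, MeasurableSet B → 0 < ρ B → ¬ BracketedOn ρ 𝒞 B (r * ρ.real B) := by
  by_contra! hcon
  refine h (BracketedOn.of_forall_mul (r := (1 + r) / 2) (by linarith) (by linarith)
    (fun B hB => ?_) hA hc)
  rcases (measureReal_nonneg (μ := ρ) (s := B)).eq_or_lt with h0 | hpos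
  · exact .of_measureReal_le (by simp [← h0])
  obtain ⟨F, hF, hFd, hFη⟩ := exists_finset_disjoint_exhaustion (ρ := ρ) hB
    (P := fun D => BracketedOn ρ 𝒞 D (r * ρ.real D)) (fun A' _ hm hp => hcon A' hm hp)
    (η := (1 - r) / 2 * ρ.real B) (by have : 0 < 1 - r := by linarith
                                      positivity)
  set U := ⋃ D ∈ F, D
  have hUm : MeasurableSet U := F.measurableSet_biUnion fun D hD => (hF D hD).2.1
  have hUB : U ⊆ B := iUnion₂_subset fun D hD => (hF D hD).1
  have hUbr : BracketedOn ρ 𝒞 U (r * ρ.real U) :=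
    .biUnion_finset F (fun D hD => (hF D hD).2.1) hFd fun D hD => (hF D hD).2.2
  have := hUbr.union hUm (hB.diff hUm) disjoint_sdiff_right (.of_measureReal_le hFη.le)
  rw [union_sdiff_cancel hUB] at this
  refine this.mono ?_
  have : r * ρ.real U ≤ r * ρ.real B := mul_le_mul_of_nonneg_left (measureReal_mono hUB) hr0
  linarith

theorem exists_forall_split {N : ℕ} {ι : Type*} [Fintype ι] [Nonempty ι]
    (hdiv : ∀ A, MeasurableSet A → ∀ t, 0 ≤ t → t ≤ ρ.real A →
      ∃ B ⊆ A, MeasurableSet B ∧ ρ.real B = t)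
    (hbad : ∀ B ⊆ A, MeasurableSet B → 0 < ρ B → ¬ BracketedOn ρ 𝒞 B ((1 - 1 / N) * ρ.real B))
    (hN : Fintype.card ι ≤ N) {D : ι → Set Y} (hDA : ∀ i, D i ⊆ A)
    (hm : ∀ i, MeasurableSet (D i)) (hd : Pairwise (Function.onFun Disjoint D))
    (hpos : ∀ i, 0 < ρ (D i)) :
    ∃ C ∈ 𝒞, ∀ i, 0 < ρ (D i ∩ C) ∧ 0 < ρ (D i \ C) := by
  by_contra! hcon
  obtain ⟨j, hj⟩ := Finite.exists_min fun i => ρ.real (D i)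
  set t := ρ.real (D j)
  have ht : 0 < t := ENNReal.toReal_pos (hpos j).ne' (measure_ne_top _ _)
  choose E hED hEm hEt using fun i => hdiv (D i) (hm i) t ht.le (hj i)
  have hU : ρ.real (⋃ i, E i) = Fintype.card ι * t := by
    rw [measureReal_iUnion_fintype (fun i i' hii' => (hd hii').mono (hED i) (hED i')) hEm]
    simp [hEt]
  have hcard : (0 : ℝ) < Fintype.card ι := by exact_mod_cast Fintype.card_pos
  have hNle : (Fintype.card ι : ℝ) ≤ N := by exact_mod_cast hN
  refine hbad (⋃ i, E i) (iUnion_subset fun i => (hED i).trans (hDA i)) (.iUnion hEm) ?_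
    (.of_not_split hEm hEt ?_ fun C hC => ?_)
  · refine (ENNReal.toReal_pos_iff.1 ?_).1
    change 0 < ρ.real _
    rw [hU]
    positivity
  · rw [hU]
    have : (Fintype.card ι : ℝ) / N ≤ 1 := div_le_one_of_le₀ hNle (by positivity)
    have := mul_le_mul_of_nonneg_right this ht.le
    have e : (1 - 1 / (N : ℝ)) * (Fintype.card ι * t) =
      Fintype.card ι * t - Fintype.card ι / N * t := by ring
    rw [e]
    linarith
  · obtain ⟨i, hi⟩ := hcon C hC
    refine ⟨i, ?_⟩
    by_contra! hne
    have h1 : 0 < ρ (D i ∩ C) :=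
      (pos_iff_ne_zero.2 hne.1).trans_le (measure_mono (inter_subset_inter_left _ (hED i)))
    have h2 : 0 < ρ (D i \ C) :=
      (pos_iff_ne_zero.2 hne.2).trans_le (measure_mono (sdiff_subset_sdiff_left (hED i)))
    exact (hi h1).not_gt h2

/-- If `𝒞` is not bracketable, it contains arbitrarily long Boolean independent sequences. -/
theorem exists_independent_of_not_bracketedOn (h𝒞 : ∀ C ∈ 𝒞, MeasurableSet C)
    (hdiv : ∀ A, MeasurableSet A → ∀ t, 0 ≤ t → t ≤ ρ.real A →
      ∃ B ⊆ A, MeasurableSet B ∧ ρ.real B = t)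
    {c : ℝ} (hc : 0 < c) (hA : MeasurableSet A) (h : ¬ BracketedOn ρ 𝒞 A c) (k : ℕ) :
    ∃ C : Fin k → Set Y, (∀ i, C i ∈ 𝒞) ∧
      ∀ s : Fin k → Bool, ∃ y, ∀ i, y ∈ C i ↔ s i = true := by
  have hN : (1 : ℝ) ≤ (2 ^ k : ℕ) := by exact_mod_cast Nat.one_le_two_pow
  obtain ⟨A₀, hA₀m, hA₀, hbad⟩ := exists_hereditarily_not_bracketedOn
    (r := 1 - 1 / (2 ^ k : ℕ)) (sub_nonneg.2 (div_le_one_of_le₀ hN (by positivity)))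
    (sub_lt_self _ (by positivity)) hc hA h
  suffices key : ∀ j ≤ k, ∃ C : Fin j → Set Y, (∀ i, C i ∈ 𝒞) ∧
      ∀ s : Fin j → Bool, 0 < ρ (A₀ ∩ {y | ∀ i, y ∈ C i ↔ s i = true}) by
    obtain ⟨C, hC, hs⟩ := key k le_rfl
    exact ⟨C, hC, fun s => (nonempty_of_measure_ne_zero (hs s).ne').imp fun y hy => hy.2⟩
  intro j
  induction j with
  | zero => exact fun _ => ⟨Fin.elim0, fun i => i.elim0, fun s => by simpa using hA₀⟩
  | succ j ih =>
    intro hj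
    obtain ⟨C, hC, hs⟩ := ih (by omega)
    obtain ⟨C', hC', hsplit⟩ := exists_forall_split hdiv hbad
      (D := fun s : Fin j → Bool => A₀ ∩ {y | ∀ i, y ∈ C i ↔ s i = true})
      (by simpa using Nat.pow_le_pow_right (n := 2) (by norm_num) (by omega : j ≤ k))
      (fun s => inter_subset_left)
      (fun s => hA₀m.inter (by
        rw [ofPred_forall]
        refine .iInter fun i => ?_
        cases s i
        · convert (h𝒞 _ (hC i)).compl using 1
          ext
          simp
        · convert h𝒞 _ (hC i) using 1
          ext
          simp))
      (fun s s' hss' => disjoint_left.2 fun y hy hy' => hss' (funext fun i =>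
        Bool.eq_iff_iff.2 ((hy.2 i).symm.trans (hy'.2 i)))) hs
    refine ⟨Fin.snoc C C', fun i => ?_, fun s => ?_⟩
    · induction i using Fin.lastCases with
      | last => simpa using hC'
      | cast i => simpa using hC i
    · obtain ⟨h1, h2⟩ := hsplit (fun i => s i.castSucc)
      cases hlast : s (Fin.last j)
      · refine h2.trans_le (measure_mono ?_)
        rintro y ⟨⟨hy, hy'⟩, hyC⟩
        refine ⟨hy, fun i => ?_⟩
        induction i using Fin.lastCases with
        | last => simpa [hlast] using hyC
        | cast i => simpa using hy' i
      · refine h1.trans_le (measure_mono ?_)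
        rintro y ⟨⟨hy, hy'⟩, hyC⟩
        refine ⟨hy, fun i => ?_⟩
        induction i using Fin.lastCases with
        | last => simpa [hlast] using hyC
        | cast i => simpa using hy' i

theorem FiniteVC.bracketedOn (hVC : FiniteVC 𝒞) (h𝒞 : ∀ C ∈ 𝒞, MeasurableSet C)
    (hdiv : ∀ A, MeasurableSet A → ∀ t, 0 ≤ t → t ≤ ρ.real A →
      ∃ B ⊆ A, MeasurableSet B ∧ ρ.real B = t)
    {c : ℝ} (hc : 0 < c) (hA : MeasurableSet A) : BracketedOn ρ 𝒞 A c := by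
  classical
  by_contra h
  obtain ⟨d, hd⟩ := hVC
  let e := Fintype.equivFin (Fin (d + 1) → Bool)
  obtain ⟨C, hC, hs⟩ := exists_independent_of_not_bracketedOn h𝒞 hdiv hc hA h
    (Fintype.card (Fin (d + 1) → Bool))
  choose y hy using fun a : Fin (d + 1) => hs fun i => e.symm i a
  have hyT : ∀ a T, y a ∈ C (e T) ↔ T a = true := fun a T => by simpa using hy a (e T)
  have hinj : Function.Injective y := fun a b hab => by
    have h1 := (hyT a fun x => decide (x = a)).2 (by simp)
    rw [hab, hyT] at h1
    exact (of_decide_eq_true h1).symm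
  have := hd (Finset.univ.map ⟨y, hinj⟩) fun B _ =>
    ⟨C (e fun a => decide (y a ∈ B)), hC _, fun x hx => by
      obtain ⟨a, -, rfl⟩ := Finset.mem_map.1 hx
      simp [hyT]⟩
  simp at this

end Independence

/-- A product with Lebesgue measure on `[0, 1]` has no atoms: every measurable set has measurable
subsets of any prescribed smaller measure. -/
theorem exists_subset_measureReal_eq_prod {X : Type*} [MeasurableSpace X] (μ : Measure X)
    [IsProbabilityMeasure μ] {A : Set (X × ℝ)} (hA : MeasurableSet A) {t : ℝ} (ht : 0 ≤ t)
    (htA : t ≤ (μ.prod (volume.restrict (Icc (0 : ℝ) 1))).real A) :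
    ∃ B ⊆ A, MeasurableSet B ∧ (μ.prod (volume.restrict (Icc (0 : ℝ) 1))).real B = t := by
  set ρ := μ.prod (volume.restrict (Icc (0 : ℝ) 1))
  have hstrip : ∀ I : Set ℝ, ρ (Prod.snd ⁻¹' I) = volume.restrict (Icc (0 : ℝ) 1) I := fun I => by
    rw [← univ_prod, Measure.prod_prod, measure_univ, one_mul]
  have hm : ∀ τ : ℝ, MeasurableSet (A ∩ Prod.snd ⁻¹' Iic τ) := fun τ =>
    hA.inter (measurable_snd measurableSet_Iic)
  set φ : ℝ → ℝ := fun τ => ρ.real (A ∩ Prod.snd ⁻¹' Iic τ)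
  have hstep : ∀ σ τ, σ ≤ τ → φ τ ≤ φ σ + (τ - σ) := fun σ τ hστ => by
    have hsub : A ∩ Prod.snd ⁻¹' Iic τ ⊆ (A ∩ Prod.snd ⁻¹' Iic σ) ∪ Prod.snd ⁻¹' Ioc σ τ := by
      rintro p ⟨hp, hpτ⟩
      rcases le_or_gt p.2 σ with h | h
      exacts [Or.inl ⟨hp, h⟩, Or.inr ⟨h, hpτ⟩]
    refine (measureReal_mono hsub).trans ((measureReal_union_le _ _).trans ?_)
    gcongr
    rw [measureReal_def, hstrip]
    refine ENNReal.toReal_le_of_le_ofReal (sub_nonneg.2 hστ) ?_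
    exact (Measure.restrict_apply_le _ _).trans (by rw [Real.volume_Ioc])
  have hmono : Monotone φ := fun σ τ hστ =>
    measureReal_mono (inter_subset_inter_right _ (preimage_mono (Iic_subset_Iic.2 hστ)))
  have hcont : Continuous φ := by
    refine (LipschitzWith.of_le_add fun τ σ => ?_).continuous
    rcases le_total σ τ with h | h
    · exact (hstep σ τ h).trans (by rw [Real.dist_eq, abs_of_nonneg (sub_nonneg.2 h)])
    · exact (hmono h).trans (by linarith [dist_nonneg (x := τ) (y := σ)])
  have h0 : φ 0 = 0 := by
    refine measureReal_mono_null inter_subset_right ?_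
    rw [measureReal_def, hstrip, Measure.restrict_apply measurableSet_Iic]
    have : Iic (0 : ℝ) ∩ Icc 0 1 ⊆ {0} := fun s hs => le_antisymm hs.1 hs.2.1
    simp [measure_mono_null this]
  have h1 : φ 1 = ρ.real A := by
    refine le_antisymm (measureReal_mono inter_subset_left) ?_
    have hnull : ρ.real (Prod.snd ⁻¹' Ioi (1 : ℝ)) = 0 := by
      rw [measureReal_def, hstrip, Measure.restrict_apply measurableSet_Ioi]
      have : Ioi (1 : ℝ) ∩ Icc 0 1 = ∅ := by
        ext s
        simp +contextual
      simp [this]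
    have hsub : A ⊆ (A ∩ Prod.snd ⁻¹' Iic (1 : ℝ)) ∪ Prod.snd ⁻¹' Ioi (1 : ℝ) := by
      intro p hp
      rcases le_or_gt p.2 1 with h | h
      exacts [Or.inl ⟨hp, h⟩, Or.inr h]
    refine (measureReal_mono hsub).trans ((measureReal_union_le _ _).trans ?_)
    rw [hnull, add_zero]
  obtain ⟨τ, -, hτ⟩ := intermediate_value_Icc zero_le_one hcont.continuousOn
    (show t ∈ Icc (φ 0) (φ 1) from ⟨h0.trans_le ht, htA.trans_eq h1.symm⟩)
  exact ⟨_, inter_subset_left, hm τ, hτ⟩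

/-- Finitely many brackets covering a pointwise dense subfamily cover the whole family. -/
theorem exists_bracket_of_tendsto {X ι : Type*} [Finite ι] {g h : ι → X → ℝ} {u : ℕ → X → ℝ}
    {f : X → ℝ} (hu : ∀ n, ∃ i, ∀ x, g i x ≤ u n x ∧ u n x ≤ h i x)
    (hlim : ∀ x, Tendsto (fun n => u n x) atTop (nhds (f x))) :
    ∃ i, ∀ x, g i x ≤ f x ∧ f x ≤ h i x := by
  choose i hi using hu
  obtain ⟨j, hj⟩ : ∃ j, ∃ᶠ n in atTop, i n = j := by
    by_contra! hcon
    obtain ⟨n, hn⟩ := (eventually_all.2 hcon).exists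
    exact hn _ rfl
  exact ⟨j, fun x => ⟨ge_of_tendsto_of_frequently (hlim x) (hj.mono fun n hn => hn ▸ (hi n x).1),
    le_of_tendsto_of_frequently (hlim x) (hj.mono fun n hn => hn ▸ (hi n x).2)⟩⟩

/-- **Bounded VC graph case.** If `ℱ` is a separable family of measurable functions with
values in `[0,1]` whose family of graphs `𝒢(ℱ) = {{(x,s) : 0 ≤ s ≤ f x} : f ∈ ℱ}` has
finite VC dimension, then `ℱ` has finite bracketing numbers with respect to every
probability measure. -/
theorem bounded_vc_graph_finite_bracketing {X : Type*} [MeasurableSpace X]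
    (ℱ : Set (X → ℝ)) (hmeas : ∀ f ∈ ℱ, Measurable f) (hsep : SeparableFamily ℱ)
    (hrange : ∀ f ∈ ℱ, ∀ x, f x ∈ Set.Icc (0 : ℝ) 1)
    (hgraph : FiniteVC ((fun f => {p : X × ℝ | 0 ≤ p.2 ∧ p.2 ≤ f p.1}) '' ℱ)) :
    ∀ μ : Measure X, IsProbabilityMeasure μ → FiniteBracketing μ ℱ := by
  classical
  intro μ _ ε hε
  set ν : Measure ℝ := volume.restrict (Icc (0 : ℝ) 1) with hν
  have : IsProbabilityMeasure ν := ⟨by simp [hν]⟩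
  have hgraphm : ∀ C ∈ (fun f => {p : X × ℝ | 0 ≤ p.2 ∧ p.2 ≤ f p.1}) '' ℱ, MeasurableSet C := by
    rintro _ ⟨f, hf, rfl⟩
    exact (measurableSet_le measurable_const measurable_snd).inter
      (measurableSet_le measurable_snd ((hmeas f hf).comp measurable_fst))
  obtain ⟨S, hS, hSm, hSC⟩ := hgraph.bracketedOn (ρ := μ.prod ν) hgraphm
    (fun A hA t ht htA => exists_subset_measureReal_eq_prod μ hA ht htA) hε MeasurableSet.univ
  obtain ⟨n, p, -, rfl⟩ := hS.fin_param
  rw [forall_mem_range] at hSm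
  simp only [univ_inter] at hSm
  have hsec : ∀ f ∈ ℱ, ∀ x, ν.real {s | 0 ≤ s ∧ s ≤ f x} = f x := fun f hf x => by
    have : {s | 0 ≤ s ∧ s ≤ f x} ∩ Icc (0 : ℝ) 1 = Icc 0 (f x) := by
      ext s
      simp only [mem_inter_iff, mem_ofPred_eq, mem_Icc]
      exact ⟨And.left, fun hs => ⟨hs, hs.1, hs.2.trans (hrange f hf x).2⟩⟩
    rw [hν, measureReal_restrict_apply' measurableSet_Icc, this,
      Real.volume_real_Icc_of_le (hrange f hf x).1, sub_zero]
  set g : Fin n → X → ℝ := fun i x => ν.real (Prod.mk x ⁻¹' ((p i).1 \ (p i).2))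
  set h : Fin n → X → ℝ := fun i x => ν.real (Prod.mk x ⁻¹' ((p i).1 ∪ (p i).2))
  have hgm : ∀ i, Measurable (g i) := fun i =>
    (measurable_measure_prodMk_left ((hSm i).1.diff (hSm i).2.1)).ennreal_toReal
  have hhm : ∀ i, Measurable (h i) := fun i =>
    (measurable_measure_prodMk_left ((hSm i).1.union (hSm i).2.1)).ennreal_toReal
  have hgh : ∀ i x, g i x ≤ h i x := fun i x =>
    measureReal_mono (preimage_mono (sdiff_subset.trans subset_union_left))
  have hint : ∀ i, ∫⁻ x, ENNReal.ofReal (h i x - g i x) ∂μ ≤ ENNReal.ofReal ε := fun i => by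
    have hle : ∀ x, ENNReal.ofReal (h i x - g i x) ≤ ν (Prod.mk x ⁻¹' (p i).2) := fun x => by
      refine ENNReal.ofReal_le_of_le_toReal ?_
      rw [sub_le_iff_le_add', ← measureReal_def]
      refine le_trans (measureReal_mono ?_) (measureReal_union_le _ _)
      rw [← preimage_union, sdiff_union_self]
    refine (lintegral_mono hle).trans ?_
    rw [← Measure.prod_apply (hSm i).2.1]
    exact (ENNReal.le_ofReal_iff_toReal_le (measure_ne_top _ _) hε.le).2 (hSm i).2.2
  have hcover : ∀ f ∈ ℱ, ∃ i, ∀ᵐ x ∂μ, g i x ≤ f x ∧ f x ≤ h i x := by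
    intro f hf
    obtain ⟨_, ⟨i, rfl⟩, hi⟩ := hSC _ (mem_image_of_mem _ hf)
    refine ⟨i, ?_⟩
    filter_upwards [Measure.ae_ae_of_ae_prod hi] with x hx
    rw [← hsec f hf x]
    constructor
    · refine ENNReal.toReal_mono (measure_ne_top _ _) (measure_mono_ae ?_)
      filter_upwards [hx] with s hs hsG
      exact (hs trivial hsG.2).2 hsG.1
    · refine ENNReal.toReal_mono (measure_ne_top _ _) (measure_mono_ae ?_)
      filter_upwards [hx] with s hs hsf
      by_cases hsE : (x, s) ∈ (p i).2
      exacts [Or.inr hsE, Or.inl ((hs trivial hsE).1 hsf)]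
  choose idx hidx using hcover
  obtain ⟨ℱ₀, hsub, hcount, hdense⟩ := hsep
  obtain ⟨M, hM, hMm, hMidx⟩ :=
    ((ae_ball_iff hcount).2 fun f hf => hidx f (hsub hf)).exists_measurable_mem
  refine ⟨n, fun i => M.piecewise (g i) 0, fun i => M.piecewise (h i) 1, fun i =>
    ⟨(hgm i).piecewise hMm measurable_const, (hhm i).piecewise hMm measurable_const, fun x => ?_,
      le_of_eq_of_le (lintegral_congr_ae ?_) (hint i)⟩, fun f hf => ?_⟩
  · by_cases hx : x ∈ M <;> simp [hx, hgh]
  · filter_upwards [hM] with x hx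
    simp [hx]
  · obtain ⟨u, hu, hlim⟩ := hdense f hf
    refine exists_bracket_of_tendsto (fun k => ⟨idx (u k) (hsub (hu k)), fun x => ?_⟩) hlim
    by_cases hx : x ∈ M
    · simpa [hx] using hMidx x hx (u k) (hu k)
    · simpa [hx] using hrange _ (hsub (hu k)) x
end
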